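/- arXiv:2512.06216 — 10 statements merged into one kernel-verified Lean document; each statement's English description precedes it below -/
import Mathlib

section
/- Let r, ψ, σ̄ be positive real numbers satisfying σ̄²ψ < min{r+1, (r+1)²/(2r), 2(r+1)²/r, (r+1)(r+4)/(2(r+2)), r/2}. Then there exists a real number Ȳ > 0 such that the following four inequalities hold simultaneously: (i) (r/((r+1)(r+2)))·σ̄²ψ·(Ȳ+1) < 1; (ii) (r/(2(r+1)(r+2)))·σ̄²ψ·(Ȳ+1)² < Ȳ; (iii) (1/(r+1))·σ̄²ψ·(Ȳ+1) < 1; (iv) (r/(2(r+1)²))·σ̄²ψ·(Ȳ+1)² < 1. -/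
/-- Lemma 1: under the smallness condition on σ̄²ψ, there exists Ȳ > 0 satisfying
the four inequalities (28)–(31). -/
theorem stmt_0 (r ψ σ : ℝ) (hr : 0 < r) (hψ : 0 < ψ) (hσ : 0 < σ)
    (h : σ ^ 2 * ψ <
      min (r + 1) (min ((r + 1) ^ 2 / (2 * r)) (min (2 * (r + 1) ^ 2 / r)
        (min ((r + 1) * (r + 4) / (2 * (r + 2))) (r / 2))))) :
    ∃ Y : ℝ, 0 < Y ∧
      r / ((r + 1) * (r + 2)) * (σ ^ 2 * ψ) * (Y + 1) < 1 ∧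
      r / (2 * (r + 1) * (r + 2)) * (σ ^ 2 * ψ) * (Y + 1) ^ 2 < Y ∧
      1 / (r + 1) * (σ ^ 2 * ψ) * (Y + 1) < 1 ∧
      r / (2 * (r + 1) ^ 2) * (σ ^ 2 * ψ) * (Y + 1) ^ 2 < 1 := by
  obtain ⟨h1, h2, -, h4, -⟩ : σ ^ 2 * ψ < r + 1 ∧ σ ^ 2 * ψ < (r + 1) ^ 2 / (2 * r) ∧
      σ ^ 2 * ψ < 2 * (r + 1) ^ 2 / r ∧ σ ^ 2 * ψ < (r + 1) * (r + 4) / (2 * (r + 2)) ∧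
      σ ^ 2 * ψ < r / 2 := by
    simpa only [lt_min_iff] using h
  have hs : 0 < σ ^ 2 * ψ := by positivity
  generalize σ ^ 2 * ψ = s at *
  rw [lt_div_iff₀ (by positivity)] at h2 h4
  set c := r / (2 * (r + 1) * (r + 2)) * s with hc
  have hc0 : 0 < c := by positivity
  -- A level satisfying the non-strict form of the third inequality, and the second one.
  obtain ⟨Z, hZ, hZ1, hZs⟩ : ∃ Z : ℝ, c * (Z + 1) ^ 2 < Z ∧ Z ≤ 1 ∧ s * (Z + 1) ≤ r + 1 := by
    by_cases hsr : 2 * s ≤ r + 1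
    · refine ⟨1, ?_, le_rfl, by linarith⟩
      have : c * (1 + 1) ^ 2 = 2 * r * s / ((r + 1) * (r + 2)) := by
        rw [hc]; field_simp; ring
      rw [this, div_lt_one (by positivity)]
      nlinarith
    · refine ⟨(r + 1) / s - 1, ?_, ?_, ?_⟩
      · have : (r + 1) / s - 1 - c * ((r + 1) / s - 1 + 1) ^ 2 =
            ((r + 1) * (r + 4) - s * (2 * (r + 2))) / (2 * (r + 2) * s) := by
          rw [hc]; field_simp; ring
        rw [← sub_pos, this]
        exact div_pos (by linarith) (by positivity)
      · have : (r + 1) / s ≤ 2 := by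
          rw [div_le_iff₀ hs]; linarith
        linarith
      · rw [sub_add_cancel, mul_div_cancel₀ _ hs.ne']
  -- Shrinking the level a little makes the third inequality strict.
  obtain ⟨Y, hYc, hYZ⟩ := exists_between hZ
  have hY0 : 0 < Y := lt_of_le_of_lt (by positivity) hYc
  have hYs : s * (Y + 1) < r + 1 := by nlinarith
  refine ⟨Y, hY0, ?_, ?_, ?_, ?_⟩
  · have : r / ((r + 1) * (r + 2)) * s * (Y + 1) = r * (s * (Y + 1)) / ((r + 1) * (r + 2)) := by
      ring
    rw [this, div_lt_one (by positivity)]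
    nlinarith
  · refine lt_of_le_of_lt ?_ hYc
    gcongr
  · have : 1 / (r + 1) * s * (Y + 1) = s * (Y + 1) / (r + 1) := by ring
    rwa [this, div_lt_one (by positivity)]
  · have : r / (2 * (r + 1) ^ 2) * s * (Y + 1) ^ 2 = r * s * (Y + 1) ^ 2 / (2 * (r + 1) ^ 2) := by
      ring
    rw [this, div_lt_one (by positivity)]
    have hY4 : (Y + 1) ^ 2 ≤ 4 := by nlinarith
    have := mul_le_mul_of_nonneg_left hY4 (mul_pos hr hs).le
    linarith
end

section
/- Let r, ψ, σ̄ be positive real numbers satisfying σ̄²ψ < min{r+1, (r+1)²/(2r), 2(r+1)²/r, (r+1)(r+4)/(2(r+2)), r/2}, and set Q = r·σ̄²ψ/((r+1)(r+2)). Then 0 < Q < 1/2 and the chain of strict inequalities (1 − √(1−2Q))/Q < √(2(r+1)/((r+2)·Q)) < r/((r+2)·Q) holds. -/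
/-- Inequality (46) of the paper: under the smallness condition on σ̄²ψ,
0 < Q < 1/2 and (1 − √(1−2Q))/Q < √(2(r+1)/((r+2)Q)) < r/((r+2)Q). -/
theorem stmt_7 (r ψ σ : ℝ) (hr : 0 < r) (hψ : 0 < ψ) (hσ : 0 < σ)
    (h : σ ^ 2 * ψ <
      min (r + 1) (min ((r + 1) ^ 2 / (2 * r)) (min (2 * (r + 1) ^ 2 / r)
        (min ((r + 1) * (r + 4) / (2 * (r + 2))) (r / 2)))))
    (Q : ℝ) (hQ : Q = r * (σ ^ 2 * ψ) / ((r + 1) * (r + 2))) :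
    0 < Q ∧ Q < 1 / 2 ∧
      (1 - Real.sqrt (1 - 2 * Q)) / Q < Real.sqrt (2 * (r + 1) / ((r + 2) * Q)) ∧
      Real.sqrt (2 * (r + 1) / ((r + 2) * Q)) < r / ((r + 2) * Q) := by
  simp only [lt_min_iff] at h
  obtain ⟨-, h₁, -, -, h₂⟩ := h
  have hs : 0 < σ ^ 2 * ψ := by positivity
  generalize σ ^ 2 * ψ = s at *
  have hQ0 : 0 < Q := by rw [hQ]; positivity
  have hQs : Q * ((r + 1) * (r + 2)) = r * s := by
    rw [hQ]; field_simp
  rw [lt_div_iff₀ (by positivity)] at h₁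
  have hQr : 2 * Q * (r + 2) < r + 1 := by
    have : (2 * Q * (r + 2)) * (r + 1) < (r + 1) * (r + 1) := by nlinarith
    exact lt_of_mul_lt_mul_right this (by positivity)
  have hQ2 : Q < 1 / 2 := by
    by_contra! hc
    nlinarith
  refine ⟨hQ0, hQ2, ?_, ?_⟩
  · have ht2 := Real.sq_sqrt (show 0 ≤ 1 - 2 * Q by linarith)
    have ht0 : 0 < Real.sqrt (1 - 2 * Q) := Real.sqrt_pos.2 (by linarith)
    generalize Real.sqrt (1 - 2 * Q) = t at *
    have ht : 1 < (2 * r + 3) * t := by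
      have hsq : 1 < (r + 2) * t ^ 2 := by rw [ht2]; linarith
      by_contra! hc
      have : ((2 * r + 3) * t) ^ 2 ≤ 1 := pow_le_one₀ (by positivity) hc
      have : (r + 2) * t ^ 2 ≤ (2 * r + 3) ^ 2 * t ^ 2 := by
        gcongr
        nlinarith
      linarith
    have ht1 : t < 1 := by nlinarith
    apply Real.lt_sqrt_of_sq_lt
    obtain rfl : Q = (1 - t) * (1 + t) / 2 := by linarith
    have h1t : 0 < 1 - t := by linarith
    have e₁ : ((1 - t) / ((1 - t) * (1 + t) / 2)) ^ 2 = 4 / (1 + t) ^ 2 := by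
      field_simp
      norm_num
    rw [e₁, div_lt_div_iff₀ (by positivity) (by positivity)]
    have : 0 < (1 + t) * ((2 * r + 3) * t - 1) := mul_pos (by positivity) (by linarith)
    nlinarith
  · rw [Real.sqrt_lt' (by positivity), div_pow,
      div_lt_div_iff₀ (by positivity) (by positivity)]
    have hlt : 2 * (r + 1) * ((r + 2) * Q) < r ^ 2 := by nlinarith
    have := mul_lt_mul_of_pos_right hlt (show 0 < (r + 2) * Q by positivity)
    linarith
end

section
/- Let r, ψ, σ̄, Ȳ be positive real numbers and let ω : [0,1] → ℝ be continuous with |ω(s)| ≤ σ̄ for all s. For a continuous function Z : [0,1] → ℝ define the truncation Ẑ(m) = max{0, min{Ȳ, Z(m)}} and define Θ̂(Z)(s) = (r·ψ/(2(r+1)))·s^{−(r+1)}·∫₀^s m^{r+1}·ω(m)²·(Ẑ(m)+1)² dm for s ∈ (0,1] and Θ̂(Z)(0) = 0. Then for any two continuous functions Z¹, Z² : [0,1] → ℝ and every s ∈ [0,1], |Θ̂(Z¹)(s) − Θ̂(Z²)(s)| ≤ (r·σ̄²ψ·(Ȳ+1)/((r+1)(r+2)))·sup_{m ∈ [0,1]}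 |Z¹(m) − Z²(m)|. -/
open MeasureTheory

/-- The truncated integral operator Θ̂ of the paper: for `s ∈ (0,1]`,
`Θ̂(Z)(s) = (rψ/(2(r+1)))·s^{-(r+1)} ∫₀^s m^{r+1} ω(m)² (Ẑ(m)+1)² dm`
where `Ẑ(m) = max{0, min{Ȳ, Z(m)}}`, and `Θ̂(Z)(0) = 0`. -/
noncomputable def ThetaHat (r ψ Ybar : ℝ) (ω : ℝ → ℝ) (Z : ℝ → ℝ) (s : ℝ) : ℝ :=
  if s = 0 then 0
  else r * ψ / (2 * (r + 1)) * s ^ (-(r + 1)) *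
    ∫ m in (0:ℝ)..s, m ^ (r + 1) * (ω m) ^ 2 * (max 0 (min Ybar (Z m)) + 1) ^ 2

lemma le_biSup_Icc_of_continuousOn {f : ℝ → ℝ} {a b : ℝ} (hf : ContinuousOn f (Set.Icc a b))
    (hf0 : ∀ x, 0 ≤ f x) {x : ℝ} (hx : x ∈ Set.Icc a b) :
    f x ≤ ⨆ m ∈ Set.Icc a b, f m := by
  obtain ⟨C, hC⟩ := (isCompact_Icc.image_of_continuousOn hf).bddAbove
  have hbdd : BddAbove (Set.range fun m => ⨆ _ : m ∈ Set.Icc a b, f m) := by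
    refine ⟨C, ?_⟩
    rintro _ ⟨m, rfl⟩
    have hC0 : 0 ≤ C := (hf0 x).trans (hC ⟨x, hx, rfl⟩)
    exact Real.iSup_le (fun hm => hC ⟨m, hm, rfl⟩) hC0
  refine le_trans ?_ (le_ciSup hbdd x)
  simp [hx]

lemma abs_sq_trunc_sub_le {Y : ℝ} (hY : 0 ≤ Y) (x y : ℝ) :
    |(max 0 (min Y x) + 1) ^ 2 - (max 0 (min Y y) + 1) ^ 2| ≤ 2 * (Y + 1) * |x - y| := by
  have hlip : |max 0 (min Y x) - max 0 (min Y y)| ≤ |x - y| := by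
    refine (abs_max_sub_max_le_max _ _ _ _).trans ?_
    simpa using abs_min_sub_min_le_max Y x Y y
  have hle (z : ℝ) : max 0 (min Y z) ≤ Y := max_le hY (min_le_left _ _)
  have hnn (z : ℝ) : 0 ≤ max 0 (min Y z) := le_max_left _ _
  rw [sq_sub_sq, abs_mul, add_sub_add_right_eq_sub]
  refine mul_le_mul ?_ hlip (abs_nonneg _) (by positivity)
  rw [abs_of_nonneg (by linarith [hnn x, hnn y])]
  linarith [hle x, hle y]

/-- Strict contraction estimate (64): for continuous `Z¹, Z²`,
`|Θ̂(Z¹)(s) − Θ̂(Z²)(s)| ≤ (rσ̄²ψ(Ȳ+1)/((r+1)(r+2)))·sup_{[0,1]}|Z¹ − Z²|`. -/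
theorem stmt_8 (r ψ σ Ybar : ℝ) (hr : 0 < r) (hψ : 0 < ψ) (hσ : 0 < σ) (hY : 0 < Ybar)
    (ω : ℝ → ℝ) (hω : ContinuousOn ω (Set.Icc 0 1))
    (hωb : ∀ s ∈ Set.Icc (0:ℝ) 1, |ω s| ≤ σ)
    (Z₁ Z₂ : ℝ → ℝ) (hZ₁ : ContinuousOn Z₁ (Set.Icc 0 1))
    (hZ₂ : ContinuousOn Z₂ (Set.Icc 0 1)) :
    ∀ s ∈ Set.Icc (0:ℝ) 1,
      |ThetaHat r ψ Ybar ω Z₁ s - ThetaHat r ψ Ybar ω Z₂ s| ≤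
        r * σ ^ 2 * ψ * (Ybar + 1) / ((r + 1) * (r + 2)) *
          ⨆ m ∈ Set.Icc (0:ℝ) 1, |Z₁ m - Z₂ m| := by
  intro s hs
  have hcont : ContinuousOn (fun m => |Z₁ m - Z₂ m|) (Set.Icc 0 1) := (hZ₁.sub hZ₂).abs
  have hD (m : ℝ) (hm : m ∈ Set.Icc (0:ℝ) 1) :=
    le_biSup_Icc_of_continuousOn hcont (fun m => abs_nonneg (Z₁ m - Z₂ m)) hm
  set D := ⨆ m ∈ Set.Icc (0:ℝ) 1, |Z₁ m - Z₂ m|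
  have hD0 : 0 ≤ D := (abs_nonneg _).trans (hD s hs)
  rcases hs.1.eq_or_lt with rfl | hs0
  · simp only [ThetaHat, if_true, sub_self, abs_zero]
    positivity
  have hsub : Set.Icc 0 s ⊆ Set.Icc (0:ℝ) 1 := Set.Icc_subset_Icc_right hs.2
  have hpow : ContinuousOn (fun m : ℝ => m ^ (r + 1)) (Set.Icc 0 1) :=
    (Real.continuous_rpow_const (by positivity)).continuousOn
  have hint (Z : ℝ → ℝ) (hZ : ContinuousOn Z (Set.Icc 0 1)) : IntervalIntegrable
      (fun m => m ^ (r + 1) * (ω m) ^ 2 * (max 0 (min Ybar (Z m)) + 1) ^ 2) volume 0 s := by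
    refine ContinuousOn.intervalIntegrable_of_Icc hs0.le (ContinuousOn.mono ?_ hsub)
    exact (hpow.mul (hω.pow 2)).mul
      (((continuousOn_const.sup (continuousOn_const.inf hZ)).add continuousOn_const).pow 2)
  have hbound (m : ℝ) (hm : m ∈ Set.Ioc 0 s) :
      ‖m ^ (r + 1) * (ω m) ^ 2 * (max 0 (min Ybar (Z₁ m)) + 1) ^ 2 -
        m ^ (r + 1) * (ω m) ^ 2 * (max 0 (min Ybar (Z₂ m)) + 1) ^ 2‖ ≤
      σ ^ 2 * (2 * (Ybar + 1) * D) * m ^ (r + 1) := by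
    have hm' : m ∈ Set.Icc (0:ℝ) 1 := hsub (Set.Ioc_subset_Icc_self hm)
    have hm0 : 0 ≤ m ^ (r + 1) := Real.rpow_nonneg hm'.1 _
    have hω2 : ω m ^ 2 ≤ σ ^ 2 := sq_le_sq' (abs_le.1 (hωb m hm')).1 (abs_le.1 (hωb m hm')).2
    have htrunc := (abs_sq_trunc_sub_le hY.le (Z₁ m) (Z₂ m)).trans
      (mul_le_mul_of_nonneg_left (hD m hm') (by positivity))
    rw [← mul_sub, Real.norm_eq_abs, abs_mul, abs_of_nonneg (by positivity), mul_assoc,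
      mul_comm (m ^ (r + 1))]
    exact mul_le_mul_of_nonneg_right (mul_le_mul hω2 htrunc (abs_nonneg _) (sq_nonneg _)) hm0
  have hmain := intervalIntegral.norm_integral_le_of_norm_le (μ := volume) hs0.le
    (Filter.Eventually.of_forall hbound)
    ((Real.continuous_rpow_const (by positivity : 0 ≤ r + 1)).const_mul
      (σ ^ 2 * (2 * (Ybar + 1) * D)) |>.intervalIntegrable 0 s)
  rw [intervalIntegral.integral_const_mul, integral_rpow (Or.inl (by linarith)),
    Real.zero_rpow (by positivity), sub_zero, Real.norm_eq_abs,
    intervalIntegral.integral_sub (hint Z₁ hZ₁) (hint Z₂ hZ₂)] at hmain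
  have hsp : s ^ (-(r + 1)) * s ^ (r + 1 + 1) = s := by
    rw [← Real.rpow_add hs0, neg_add_cancel_left, Real.rpow_one]
  have hc : 0 ≤ r * ψ / (2 * (r + 1)) * s ^ (-(r + 1)) := by positivity
  simp only [ThetaHat, if_neg hs0.ne']
  rw [← mul_sub, abs_mul, abs_of_nonneg hc]
  refine (mul_le_mul_of_nonneg_left hmain hc).trans ?_
  calc r * ψ / (2 * (r + 1)) * s ^ (-(r + 1)) *
        (σ ^ 2 * (2 * (Ybar + 1) * D) * (s ^ (r + 1 + 1) / (r + 1 + 1)))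
      = r * σ ^ 2 * ψ * (Ybar + 1) / ((r + 1) * (r + 2)) * D *
          (s ^ (-(r + 1)) * s ^ (r + 1 + 1)) := by
        rw [add_assoc r 1 1, one_add_one_eq_two]
        field_simp
    _ ≤ r * σ ^ 2 * ψ * (Ybar + 1) / ((r + 1) * (r + 2)) * D := by
        rw [hsp]
        exact mul_le_of_le_one_right (by positivity) hs.2
end

section
/- Let r, ψ, σ̄ be positive real numbers with σ̄²ψ < r/2, let Ȳ > 0 satisfy (i) (r/((r+1)(r+2)))·σ̄²ψ·(Ȳ+1) < 1 and (ii) (r/(2(r+1)(r+2)))·σ̄²ψ·(Ȳ+1)² < Ȳ, and let ω : [0,1] → ℝ be continuous with 0 < ω(s) ≤ σ̄ for all s. Then there exists a unique nonnegative continuous function Z : [0,1] → ℝ such that Z(0) = 0 and Z(s) = (r·ψ/(2(r+1)))·s^{−(r+1)}·∫₀^s m^{r+1}·ω(m)²·(Z(m)+1)² dm for all s ∈ (0,1]; moreover this Z satisfies 0 ≤ Z(s) ≤ r·σ̄²ψ·(Ȳ+1)²/(2(r+1)(r+2)) < Ȳ for all s ∈ [0,1]. -/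
open MeasureTheory

/-- The weighted average `s ∫₀¹ t^(r+1) g(st) dt`, which equals `s^(-(r+1)) ∫₀ˢ m^(r+1) g(m) dm`
for `s > 0` and depends continuously on `s` up to `s = 0`. -/
noncomputable def weightedAverage (r : ℝ) (g : ℝ → ℝ) (s : ℝ) : ℝ :=
  s * ∫ t in (0:ℝ)..1, t ^ (r + 1) * g (s * t)

theorem weightedAverage_eq {r s : ℝ} (g : ℝ → ℝ) (hs : 0 < s) :
    weightedAverage r g s = s ^ (-(r + 1)) * ∫ m in (0:ℝ)..s, m ^ (r + 1) * g m := by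
  have h := intervalIntegral.mul_integral_comp_mul_left (a := 0) (b := 1)
    (f := fun m => m ^ (r + 1) * g m) s
  simp only [mul_zero, mul_one] at h
  rw [weightedAverage, ← h, mul_left_comm, ← intervalIntegral.integral_const_mul (s ^ (-(r + 1)))]
  congr 1
  refine intervalIntegral.integral_congr fun t ht => ?_
  rw [Set.uIcc_of_le zero_le_one] at ht
  have hpow : s ^ (-(r + 1)) * s ^ (r + 1) = 1 := by
    rw [← Real.rpow_add hs]; simp
  simp only [Real.mul_rpow hs.le ht.1]
  linear_combination (-(t ^ (r + 1) * g (s * t))) * hpow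

theorem continuous_rpow_mul_comp_mul {r : ℝ} (hr : 0 < r) {g : ℝ → ℝ} (hg : Continuous g) (s : ℝ) :
    Continuous fun t : ℝ => t ^ (r + 1) * g (s * t) := by
  have := Real.continuous_rpow_const (q := r + 1) (by linarith)
  fun_prop

theorem continuous_weightedAverage {r : ℝ} (hr : 0 < r) {g : ℝ → ℝ} (hg : Continuous g) :
    Continuous (weightedAverage r g) := by
  have hp := Real.continuous_rpow_const (q := r + 1) (by linarith)
  refine continuous_id.mul
    (intervalIntegral.continuous_parametric_intervalIntegral_of_continuous' ?_ 0 1)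
  simp only [Function.uncurry_def]
  fun_prop

theorem weightedAverage_nonneg {r s : ℝ} {g : ℝ → ℝ} (hg : ∀ x, 0 ≤ g x) (hs : 0 ≤ s) :
    0 ≤ weightedAverage r g s :=
  mul_nonneg hs <| intervalIntegral.integral_nonneg zero_le_one fun _ ht =>
    mul_nonneg (Real.rpow_nonneg ht.1 _) (hg _)

theorem weightedAverage_le {r s M : ℝ} (hr : 0 < r) {g : ℝ → ℝ} (hg : Continuous g)
    (hM : 0 ≤ M) (hgM : ∀ x, g x ≤ M) (hs : s ∈ Set.Icc (0:ℝ) 1) :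
    weightedAverage r g s ≤ M / (r + 2) := by
  have hp := Real.continuous_rpow_const (q := r + 1) (by linarith)
  have hint : ∫ t in (0:ℝ)..1, t ^ (r + 1) * M = M / (r + 2) := by
    rw [intervalIntegral.integral_mul_const, integral_rpow (Or.inl (by linarith)),
      Real.one_rpow, Real.zero_rpow (by linarith)]
    ring
  have hle : ∫ t in (0:ℝ)..1, t ^ (r + 1) * g (s * t) ≤ M / (r + 2) := by
    rw [← hint]
    refine intervalIntegral.integral_mono_on zero_le_one
      ((continuous_rpow_mul_comp_mul hr hg s).intervalIntegrable _ _)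
      ((hp.mul continuous_const).intervalIntegrable _ _) fun t ht => ?_
    exact mul_le_mul_of_nonneg_left (hgM _) (Real.rpow_nonneg ht.1 _)
  calc weightedAverage r g s ≤ s * (M / (r + 2)) := mul_le_mul_of_nonneg_left hle hs.1
    _ ≤ M / (r + 2) := mul_le_of_le_one_left (by positivity) hs.2

theorem weightedAverage_sub {r : ℝ} (hr : 0 < r) {f g : ℝ → ℝ} (hf : Continuous f)
    (hg : Continuous g) (s : ℝ) :
    weightedAverage r f s - weightedAverage r g s = weightedAverage r (fun x => f x - g x) s := by
  simp only [weightedAverage, mul_sub]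
  rw [intervalIntegral.integral_sub
    ((continuous_rpow_mul_comp_mul hr hf s).intervalIntegrable _ _)
    ((continuous_rpow_mul_comp_mul hr hg s).intervalIntegrable _ _), mul_sub]

/-- The integrand `ω² (Z + 1)²`, with `Z` truncated to `[0, Y]` and both functions extended
from `[0, 1]` to `ℝ` by constants. -/
noncomputable def truncatedIntegrand {Y : ℝ} (hY : 0 < Y) (ω : ℝ → ℝ)
    (Z : C(Set.Icc (0:ℝ) 1, ℝ)) (x : ℝ) : ℝ :=
  ω (Set.projIcc 0 1 zero_le_one x) ^ 2 *
    ((Set.projIcc 0 Y hY.le (Z (Set.projIcc 0 1 zero_le_one x)) : ℝ) + 1) ^ 2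

section

variable {r Y σ K : ℝ} (hY : 0 < Y) {ω : ℝ → ℝ} (Z : C(Set.Icc (0:ℝ) 1, ℝ))

theorem continuous_truncatedIntegrand (hω : ContinuousOn ω (Set.Icc 0 1)) :
    Continuous (truncatedIntegrand hY ω Z) := by
  have h1 : Continuous fun x => ω (Set.projIcc (0:ℝ) 1 zero_le_one x) :=
    hω.domRestrict.comp continuous_projIcc
  have h2 : Continuous fun x =>
      (Set.projIcc 0 Y hY.le (Z (Set.projIcc 0 1 zero_le_one x)) : ℝ) :=
    continuous_subtype_val.comp
      (continuous_projIcc.comp (Z.continuous.comp continuous_projIcc))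
  exact (h1.pow 2).mul ((h2.add continuous_const).pow 2)

theorem truncatedIntegrand_nonneg (x : ℝ) : 0 ≤ truncatedIntegrand hY ω Z x := by
  unfold truncatedIntegrand; positivity

theorem sq_comp_projIcc_le (hωb : ∀ s ∈ Set.Icc (0:ℝ) 1, 0 < ω s ∧ ω s ≤ σ) (x : ℝ) :
    ω (Set.projIcc 0 1 zero_le_one x) ^ 2 ≤ σ ^ 2 := by
  have h := hωb _ (Set.projIcc (0:ℝ) 1 zero_le_one x).2
  exact pow_le_pow_left₀ h.1.le h.2 2

theorem truncatedIntegrand_le (hωb : ∀ s ∈ Set.Icc (0:ℝ) 1, 0 < ω s ∧ ω s ≤ σ) (x : ℝ) :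
    truncatedIntegrand hY ω Z x ≤ σ ^ 2 * (Y + 1) ^ 2 := by
  have h := (Set.projIcc 0 Y hY.le (Z (Set.projIcc 0 1 zero_le_one x))).2
  exact mul_le_mul (sq_comp_projIcc_le hωb x)
    (pow_le_pow_left₀ (by linarith [h.1]) (by linarith [h.2]) 2) (by positivity) (by positivity)

theorem truncatedIntegrand_sub_le (hωb : ∀ s ∈ Set.Icc (0:ℝ) 1, 0 < ω s ∧ ω s ≤ σ)
    (W : C(Set.Icc (0:ℝ) 1, ℝ)) (x : ℝ) :
    truncatedIntegrand hY ω Z x - truncatedIntegrand hY ω W x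
      ≤ σ ^ 2 * (2 * (Y + 1)) * dist Z W := by
  unfold truncatedIntegrand
  have hσx := sq_comp_projIcc_le hωb x
  set p := Set.projIcc (0:ℝ) 1 zero_le_one x
  have hd : dist (Z p) (W p) ≤ dist Z W := ContinuousMap.dist_apply_le_dist p
  rw [Real.dist_eq] at hd
  have hab := (Set.abs_projIcc_sub_projIcc hY.le (c := Z p) (d := W p)).trans hd
  have ha := (Set.projIcc 0 Y hY.le (Z p)).2
  have hb := (Set.projIcc 0 Y hY.le (W p)).2
  set a : ℝ := (Set.projIcc 0 Y hY.le (Z p)).1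
  set b : ℝ := (Set.projIcc 0 Y hY.le (W p)).1
  calc ω p ^ 2 * (a + 1) ^ 2 - ω p ^ 2 * (b + 1) ^ 2
      = ω p ^ 2 * ((a + b + 2) * (a - b)) := by ring
    _ ≤ ω p ^ 2 * (2 * (Y + 1) * dist Z W) := by
        refine mul_le_mul_of_nonneg_left ?_ (sq_nonneg _)
        calc (a + b + 2) * (a - b) ≤ (a + b + 2) * dist Z W :=
              mul_le_mul_of_nonneg_left ((le_abs_self _).trans hab) (by linarith [ha.1, hb.1])
          _ ≤ 2 * (Y + 1) * dist Z W :=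
              mul_le_mul_of_nonneg_right (by linarith [ha.2, hb.2]) dist_nonneg
    _ ≤ σ ^ 2 * (2 * (Y + 1) * dist Z W) :=
        mul_le_mul_of_nonneg_right hσx (by positivity)
    _ = _ := by ring

theorem weightedAverage_truncatedIntegrand {f : ℝ → ℝ} {s : ℝ} (hs : s ∈ Set.Ioc (0:ℝ) 1)
    (hZ : ∀ x : Set.Icc (0:ℝ) 1, Z x = f x) (hf : ∀ m ∈ Set.Icc 0 s, f m ∈ Set.Icc 0 Y) :
    weightedAverage r (truncatedIntegrand hY ω Z) s =
      s ^ (-(r + 1)) * ∫ m in (0:ℝ)..s, m ^ (r + 1) * (ω m) ^ 2 * (f m + 1) ^ 2 := by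
  rw [weightedAverage_eq _ hs.1]
  congr 1
  refine intervalIntegral.integral_congr fun m hm => ?_
  rw [Set.uIcc_of_le hs.1.le] at hm
  have hm1 : m ∈ Set.Icc (0:ℝ) 1 := ⟨hm.1, hm.2.trans hs.2⟩
  simp only [truncatedIntegrand, hZ, Set.projIcc_of_mem zero_le_one hm1,
    Set.projIcc_of_mem hY.le (hf m hm), mul_assoc]

/-- The Picard operator of the fixed-point equation, with truncated argument. -/
noncomputable def truncatedPicard (hr : 0 < r) (K : ℝ) (hω : ContinuousOn ω (Set.Icc 0 1)) :
    C(Set.Icc (0:ℝ) 1, ℝ) where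
  toFun s := K * weightedAverage r (truncatedIntegrand hY ω Z) s
  continuous_toFun := continuous_const.mul
    ((continuous_weightedAverage hr (continuous_truncatedIntegrand hY Z hω)).comp
      continuous_subtype_val)

theorem dist_truncatedPicard_le (hr : 0 < r) (hK : 0 ≤ K) (hω : ContinuousOn ω (Set.Icc 0 1))
    (hωb : ∀ s ∈ Set.Icc (0:ℝ) 1, 0 < ω s ∧ ω s ≤ σ) (W : C(Set.Icc (0:ℝ) 1, ℝ)) :
    dist (truncatedPicard hY Z hr K hω) (truncatedPicard hY W hr K hω)
      ≤ K * (σ ^ 2 * (2 * (Y + 1)) / (r + 2)) * dist Z W := by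
  have key : ∀ (Z W : C(Set.Icc (0:ℝ) 1, ℝ)) (s : Set.Icc (0:ℝ) 1),
      truncatedPicard hY Z hr K hω s - truncatedPicard hY W hr K hω s
        ≤ K * (σ ^ 2 * (2 * (Y + 1)) / (r + 2)) * dist Z W := by
    intro Z W s
    have hZc := continuous_truncatedIntegrand hY Z hω
    have hWc := continuous_truncatedIntegrand hY W hω
    calc truncatedPicard hY Z hr K hω s - truncatedPicard hY W hr K hω s
        = K * weightedAverage r
            (fun x => truncatedIntegrand hY ω Z x - truncatedIntegrand hY ω W x) s := by
          rw [← weightedAverage_sub hr hZc hWc]; exact (mul_sub _ _ _).symm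
      _ ≤ K * (σ ^ 2 * (2 * (Y + 1)) * dist Z W / (r + 2)) :=
          mul_le_mul_of_nonneg_left (weightedAverage_le hr (hZc.sub hWc) (by positivity)
            (truncatedIntegrand_sub_le hY Z hωb W) s.2) hK
      _ = _ := by ring
  refine (ContinuousMap.dist_le (by positivity)).2 fun s => abs_sub_le_iff.2 ⟨key Z W s, ?_⟩
  rw [dist_comm Z W]
  exact key W Z s

theorem truncatedPicard_mem_Icc (hr : 0 < r) (hK : 0 ≤ K) (hω : ContinuousOn ω (Set.Icc 0 1))
    (hωb : ∀ s ∈ Set.Icc (0:ℝ) 1, 0 < ω s ∧ ω s ≤ σ) (s : Set.Icc (0:ℝ) 1) :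
    truncatedPicard hY Z hr K hω s ∈ Set.Icc 0 (K * (σ ^ 2 * (Y + 1) ^ 2 / (r + 2))) :=
  ⟨mul_nonneg hK (weightedAverage_nonneg (truncatedIntegrand_nonneg hY Z) s.2.1),
    mul_le_mul_of_nonneg_left (weightedAverage_le hr (continuous_truncatedIntegrand hY Z hω)
      (by positivity) (truncatedIntegrand_le hY Z hωb) s.2) hK⟩

end

/-- A continuous function on `[0, 1]` starting below `Y` stays below `Y` if it is smaller than `Y`
at every positive point up to which it does not exceed `Y`. -/
theorem ContinuousOn.lt_of_bootstrap {f : ℝ → ℝ} {Y : ℝ} (hf : ContinuousOn f (Set.Icc 0 1))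
    (h0 : f 0 < Y)
    (hstep : ∀ t ∈ Set.Ioc (0:ℝ) 1, (∀ m ∈ Set.Icc 0 t, f m ≤ Y) → f t < Y) :
    ∀ s ∈ Set.Icc (0:ℝ) 1, f s < Y := by
  intro s hs
  by_contra! hsY
  obtain ⟨t, ⟨ht, htY⟩, hleast⟩ :=
    (hf.preimage_isClosed_of_isClosed isClosed_Icc (isClosed_Ici (a := Y))
      |> isCompact_Icc.of_isClosed_subset <| Set.inter_subset_left).exists_isLeast ⟨s, hs, hsY⟩
  have htpos : 0 < t := lt_of_le_of_ne ht.1 fun h => by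
    subst h; exact absurd h0 (not_lt.2 htY)
  obtain ⟨u, hu, huY⟩ := intermediate_value_Icc ht.1
    (hf.mono (Set.Icc_subset_Icc_right ht.2)) ⟨h0.le, htY⟩
  have htu : t ≤ u := hleast ⟨⟨hu.1, hu.2.trans ht.2⟩, huY.ge⟩
  have hut : u = t := le_antisymm hu.2 htu
  rw [hut] at huY
  refine (hstep t ⟨htpos, ht.2⟩ fun m hm => ?_).ne huY
  by_contra! hmY
  have hmt : t ≤ m := hleast ⟨⟨hm.1, hm.2.trans ht.2⟩, hmY.le⟩
  rw [le_antisymm hm.2 hmt] at hmY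
  exact hmY.ne' huY

/-- Existence, uniqueness and bounds for the fixed-point problem (61):
`Z(s) = (rψ/(2(r+1)))·s^{-(r+1)} ∫₀^s m^{r+1} ω(m)² (Z(m)+1)² dm` on `(0,1]`,
`Z(0) = 0`, with `0 ≤ Z ≤ rσ̄²ψ(Ȳ+1)²/(2(r+1)(r+2)) < Ȳ`. -/
theorem stmt_10 (r ψ σ Ybar : ℝ) (hr : 0 < r) (hψ : 0 < ψ) (hσ : 0 < σ) (hY : 0 < Ybar)
    (hsmall : σ ^ 2 * ψ < r / 2)
    (h1 : r / ((r + 1) * (r + 2)) * (σ ^ 2 * ψ) * (Ybar + 1) < 1)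
    (h2 : r / (2 * (r + 1) * (r + 2)) * (σ ^ 2 * ψ) * (Ybar + 1) ^ 2 < Ybar)
    (ω : ℝ → ℝ) (hω : ContinuousOn ω (Set.Icc 0 1))
    (hωb : ∀ s ∈ Set.Icc (0:ℝ) 1, 0 < ω s ∧ ω s ≤ σ) :
    ∃ Z : ℝ → ℝ, ContinuousOn Z (Set.Icc 0 1) ∧ Z 0 = 0 ∧
      (∀ s ∈ Set.Ioc (0:ℝ) 1,
        Z s = r * ψ / (2 * (r + 1)) * s ^ (-(r + 1)) *
          ∫ m in (0:ℝ)..s, m ^ (r + 1) * (ω m) ^ 2 * (Z m + 1) ^ 2) ∧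
      (∀ s ∈ Set.Icc (0:ℝ) 1,
        0 ≤ Z s ∧ Z s ≤ r * σ ^ 2 * ψ * (Ybar + 1) ^ 2 / (2 * (r + 1) * (r + 2))) ∧
      r * σ ^ 2 * ψ * (Ybar + 1) ^ 2 / (2 * (r + 1) * (r + 2)) < Ybar ∧
      (∀ s ∈ Set.Icc (0:ℝ) 1, 0 ≤ Z s) ∧
      ∀ Z' : ℝ → ℝ, ContinuousOn Z' (Set.Icc 0 1) → (∀ s ∈ Set.Icc (0:ℝ) 1, 0 ≤ Z' s) →
        Z' 0 = 0 →
        (∀ s ∈ Set.Ioc (0:ℝ) 1,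
          Z' s = r * ψ / (2 * (r + 1)) * s ^ (-(r + 1)) *
            ∫ m in (0:ℝ)..s, m ^ (r + 1) * (ω m) ^ 2 * (Z' m + 1) ^ 2) →
        ∀ s ∈ Set.Icc (0:ℝ) 1, Z' s = Z s := by
  have hK : 0 ≤ r * ψ / (2 * (r + 1)) := by positivity
  set K := r * ψ / (2 * (r + 1)) with hKdef
  have hB : K * (σ ^ 2 * (Ybar + 1) ^ 2 / (r + 2)) =
      r * σ ^ 2 * ψ * (Ybar + 1) ^ 2 / (2 * (r + 1) * (r + 2)) := by
    rw [hKdef]; field_simp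
  have hBY : r * σ ^ 2 * ψ * (Ybar + 1) ^ 2 / (2 * (r + 1) * (r + 2)) < Ybar := by
    convert h2 using 1; field_simp
  have hq : K * (σ ^ 2 * (2 * (Ybar + 1)) / (r + 2)) < 1 := by
    convert h1 using 1; rw [hKdef]; field_simp
  have hq0 : 0 ≤ K * (σ ^ 2 * (2 * (Ybar + 1)) / (r + 2)) := by positivity
  have hmem := fun Z => truncatedPicard_mem_Icc hY Z hr hK hω hωb
  rw [hB] at hmem
  have hcontr : ContractingWith ⟨_, hq0⟩ fun Z => truncatedPicard hY Z hr K hω :=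
    ⟨hq, LipschitzWith.of_dist_le_mul fun Z W => dist_truncatedPicard_le hY Z hr hK hω hωb W⟩
  set Z := hcontr.fixedPoint
  have hfix : truncatedPicard hY Z hr K hω = Z := hcontr.fixedPoint_isFixedPt
  have hZmem : ∀ s : Set.Icc (0:ℝ) 1,
      Z s ∈ Set.Icc 0 (r * σ ^ 2 * ψ * (Ybar + 1) ^ 2 / (2 * (r + 1) * (r + 2))) :=
    fun s => hfix ▸ hmem Z s
  have hZext : ∀ s : Set.Icc (0:ℝ) 1, Z s = Set.IccExtend zero_le_one Z s :=
    fun s => (Set.IccExtend_val zero_le_one Z s).symm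
  refine ⟨Set.IccExtend zero_le_one Z, (Z.continuous.Icc_extend').continuousOn, ?_, ?_,
    fun s _ => hZmem _, hBY, fun s _ => (hZmem _).1, ?_⟩
  · rw [Set.IccExtend_left, ← hfix]
    simp [truncatedPicard, weightedAverage]
  · intro s hs
    rw [mul_assoc, ← weightedAverage_truncatedIntegrand hY Z hs hZext
      fun m _ => ⟨(hZmem _).1, (hZmem _).2.trans hBY.le⟩,
      Set.IccExtend_of_mem _ _ (Set.Ioc_subset_Icc_self hs)]
    exact (DFunLike.congr_fun hfix _).symm
  · intro f hf hf0 hfz hfeq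
    let F : C(Set.Icc (0:ℝ) 1, ℝ) := ⟨Set.domRestrict (Set.Icc 0 1) f, hf.domRestrict⟩
    have hF : ∀ s (hs : s ∈ Set.Ioc (0:ℝ) 1), (∀ m ∈ Set.Icc 0 s, f m ≤ Ybar) →
        f s = truncatedPicard hY F hr K hω ⟨s, Set.Ioc_subset_Icc_self hs⟩ := by
      intro s hs hle
      rw [hfeq s hs, mul_assoc, ← weightedAverage_truncatedIntegrand hY F hs (fun _ => rfl)
        fun m hm => ⟨hf0 m ⟨hm.1, hm.2.trans hs.2⟩, hle m hm⟩]
      rfl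
    have hfY : ∀ s ∈ Set.Icc (0:ℝ) 1, f s < Ybar := by
      refine hf.lt_of_bootstrap (hfz.trans_lt hY) fun t ht hle => ?_
      rw [hF t ht hle]
      exact (hmem F _).2.trans_lt hBY
    have hFfix : truncatedPicard hY F hr K hω = F := by
      ext s
      rcases s.2.1.eq_or_lt with h | h
      · have hs : s = ⟨0, by simp⟩ := Subtype.ext h.symm
        subst hs
        exact (by simp [truncatedPicard, weightedAverage] :
          truncatedPicard hY F hr K hω ⟨0, _⟩ = 0).trans hfz.symm
      · exact (hF s ⟨h, s.2.2⟩ fun m hm => (hfY m ⟨hm.1, hm.2.trans s.2.2⟩).le).symm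
    intro s hs
    rw [Set.IccExtend_of_mem _ _ hs]
    exact DFunLike.congr_fun (hcontr.fixedPoint_unique hFfix) ⟨s, hs⟩
end

section
/- Let r, ψ, σ̄ be positive real numbers and let ω : [0,1] → ℝ be continuous with 0 < ω(s) ≤ σ̄ for all s. Suppose Z : [0,1] → ℝ is continuous, bounded, Z(0) = 0, and Z(s) = (r·ψ/(2(r+1)))·s^{−(r+1)}·∫₀^s m^{r+1}·ω(m)²·(Z(m)+1)² dm for all s ∈ (0,1]. Then Z is continuously differentiable on (0,1] and satisfies Z′(s) = −((r+1)/s)·Z(s) + (r/(2(r+1)))·ω(s)²·ψ·(Z(s)+1)² for all s ∈ (0,1]. -/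
open MeasureTheory

theorem ContinuousOn.hasDerivWithinAt_integral_Icc {f : ℝ → ℝ} {a b s : ℝ}
    (hf : ContinuousOn f (Set.Icc a b)) (hs : s ∈ Set.Icc a b) :
    HasDerivWithinAt (fun u => ∫ m in a..u, f m) (f s) (Set.Icc a b) s := by
  have : Fact (s ∈ Set.Icc a b) := ⟨hs⟩
  refine intervalIntegral.integral_hasDerivWithinAt_right ?_
    (hf.stronglyMeasurableAtFilter_nhdsWithin measurableSet_Icc s) (hf s hs)
  refine (hf.mono ?_).intervalIntegrable
  rw [Set.uIcc_of_le hs.1]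
  exact Set.Icc_subset_Icc_right hs.2

/-- Any bounded continuous solution of the fixed-point problem (61) is continuously
differentiable on `(0,1]` and solves the ODE (60):
`Z′(s) = −((r+1)/s)·Z(s) + (r/(2(r+1)))·ω(s)²ψ·(Z(s)+1)²`. -/
theorem stmt_11 (r ψ σ : ℝ) (hr : 0 < r) (hψ : 0 < ψ) (hσ : 0 < σ)
    (ω : ℝ → ℝ) (hω : ContinuousOn ω (Set.Icc 0 1))
    (hωb : ∀ s ∈ Set.Icc (0:ℝ) 1, 0 < ω s ∧ ω s ≤ σ)
    (Z : ℝ → ℝ) (hZc : ContinuousOn Z (Set.Icc 0 1))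
    (hZb : ∃ C : ℝ, ∀ s ∈ Set.Icc (0:ℝ) 1, |Z s| ≤ C)
    (hZ0 : Z 0 = 0)
    (hZfix : ∀ s ∈ Set.Ioc (0:ℝ) 1,
      Z s = r * ψ / (2 * (r + 1)) * s ^ (-(r + 1)) *
        ∫ m in (0:ℝ)..s, m ^ (r + 1) * (ω m) ^ 2 * (Z m + 1) ^ 2) :
    (∀ s ∈ Set.Ioc (0:ℝ) 1,
      HasDerivWithinAt Z
        (-((r + 1) / s) * Z s + r / (2 * (r + 1)) * (ω s) ^ 2 * ψ * (Z s + 1) ^ 2)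
        (Set.Ioc 0 1) s) ∧
      ContinuousOn
        (fun s => -((r + 1) / s) * Z s + r / (2 * (r + 1)) * (ω s) ^ 2 * ψ * (Z s + 1) ^ 2)
        (Set.Ioc 0 1) := by
  have hsub : Set.Ioc (0:ℝ) 1 ⊆ Set.Icc 0 1 := Set.Ioc_subset_Icc_self
  constructor
  · intro s hs
    have hs0 : 0 < s := hs.1
    have hcont : ContinuousOn (fun m : ℝ => m ^ (r + 1) * (ω m) ^ 2 * (Z m + 1) ^ 2)
        (Set.Icc 0 1) :=
      ((Real.continuous_rpow_const (by positivity)).continuousOn.mul (hω.pow 2)).mul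
        ((hZc.add continuousOn_const).pow 2)
    have hint := (hcont.hasDerivWithinAt_integral_Icc (hsub hs)).mono hsub
    have hpow := ((Real.hasDerivAt_rpow_const (p := -(r + 1))
      (Or.inl hs0.ne')).const_mul (r * ψ / (2 * (r + 1)))).hasDerivWithinAt (s := Set.Ioc 0 1)
    refine ((hpow.mul hint).congr hZfix (hZfix s hs)).congr_deriv ?_
    have hcancel : s ^ (-(r + 1)) * s ^ (r + 1) = 1 := by
      rw [← Real.rpow_add hs0, neg_add_cancel, Real.rpow_zero]
    have hfix := hZfix s hs
    rw [Real.rpow_sub_one hs0.ne']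
    generalize (∫ m in (0:ℝ)..s, m ^ (r + 1) * (ω m) ^ 2 * (Z m + 1) ^ 2) = I at *
    linear_combination ((r + 1) / s) * hfix +
      (r * ψ / (2 * (r + 1)) * (ω s) ^ 2 * (Z s + 1) ^ 2) * hcancel
  · have hZ := hZc.mono hsub
    have hw := hω.mono hsub
    have hdiv : ContinuousOn (fun s : ℝ => -((r + 1) / s)) (Set.Ioc 0 1) :=
      (continuousOn_const.div continuousOn_id fun s hs => hs.1.ne').neg
    fun_prop
end

section
/- Let r, ψ, σ̄ be positive real numbers with σ̄²ψ < r/2 and let σ : [0,1] → ℝ be continuous with 0 < σ(t) ≤ σ̄ for all t. Then there exists a unique nonnegative function A : [0,1] → ℝ that is continuous on [0,1], continuously differentiable on [0,1), satisfies A(1) = 0, and solves the terminal value problem −A′(t) = (r/(1−t))·(−A(t) + (σ(t)²ψ/2)·A(t)²) + 1 for all t ∈ [0,1). Moreover, for every Ȳ > 0 satisfying (i) (r/((r+1)(r+2)))·σ̄²ψ·(Ȳ+1) < 1 and (ii) (r/(2(r+1)(r+2)))·σ̄²ψ·(Ȳ+1)² < Ȳ, one has 0 ≤ A(t) ≤ (1+Ȳ)·(1−t)/(1+r)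 for all t ∈ [0,1]. -/
open Set in
/-- A contraction argument for the integral form of the singular Riccati equation
`s y' = 1 - (r + 1) y + r k(s) s y²`. -/
theorem exists_continuous_eq_integral_rpow_mul {r κ R : ℝ} {k : ℝ → ℝ} (hr : 0 < r)
    (hk : Continuous k) (hk0 : ∀ x, 0 ≤ k x) (hkκ : ∀ x, k x ≤ κ) (hR : 0 ≤ R)
    (hmaps : 1 / (r + 1) + r * κ * R ^ 2 / (r + 2) ≤ R)
    (hcontr : 2 * r * κ * R / (r + 2) < 1) :
    ∃ y : ℝ → ℝ, Continuous y ∧ (∀ s ∈ Icc (0 : ℝ) 1, 0 ≤ y s ∧ y s ≤ R) ∧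
      ∀ s ∈ Icc (0 : ℝ) 1,
        y s = ∫ v in (0 : ℝ)..1, v ^ r * (1 + r * k (s * v) * (s * v) * y (s * v) ^ 2) := by
  have hκ : 0 ≤ κ := (hk0 0).trans (hkκ 0)
  have hpow : Continuous fun v : ℝ => v ^ r := Real.continuous_rpow_const hr.le
  have hpow' : Continuous fun v : ℝ => v ^ (r + 1) := Real.continuous_rpow_const (by linarith)
  have hint : ∫ v in (0 : ℝ)..1, v ^ r = 1 / (r + 1) := by
    rw [integral_rpow (Or.inl (by linarith))]
    simp [Real.zero_rpow (by linarith : r + 1 ≠ 0)]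
  have hint' : ∫ v in (0 : ℝ)..1, v ^ (r + 1) = 1 / (r + 2) := by
    rw [integral_rpow (Or.inl (by linarith)), Real.zero_rpow (by linarith : r + 1 + 1 ≠ 0)]
    simp only [Real.one_rpow]
    ring_nf
  let φ : ℝ → ℝ := fun x => max 0 (min x R)
  have hφc : Continuous φ := by fun_prop
  have hφ0 : ∀ x, 0 ≤ φ x := fun x => le_max_left _ _
  have hφR : ∀ x, φ x ≤ R := fun x => max_le hR (min_le_right _ _)
  have hφid : ∀ x, 0 ≤ x → x ≤ R → φ x = x := fun x h0 h1 => by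
    simp only [φ]; rw [min_eq_left h1, max_eq_right h0]
  have hφlip : ∀ x y, |φ x - φ y| ≤ |x - y| := fun x y =>
    (abs_max_sub_max_le_max _ _ _ _).trans (by
      simpa using (abs_min_sub_min_le_max x R y R))
  let h : C(Icc (0 : ℝ) 1, ℝ) → ℝ → ℝ := fun y x =>
    1 + r * k x * x * φ (IccExtend zero_le_one y x) ^ 2
  have hhc : ∀ y, Continuous (h y) := fun y => by
    have : Continuous (IccExtend (zero_le_one (α := ℝ)) y) := y.continuous.Icc_extend'
    fun_prop
  let T : C(Icc (0 : ℝ) 1, ℝ) → C(Icc (0 : ℝ) 1, ℝ) := fun y =>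
    ⟨fun s => ∫ v in (0 : ℝ)..1, v ^ r * h y (s * v), by
      have := hhc y
      exact intervalIntegral.continuous_parametric_intervalIntegral_of_continuous' (by fun_prop) _ _⟩
  have hT : ∀ y s, T y s = ∫ v in (0 : ℝ)..1, v ^ r * h y (s * v) := fun _ _ => rfl
  have hicont : ∀ y (s : Icc (0 : ℝ) 1),
      IntervalIntegrable (fun v : ℝ => v ^ r * h y (s * v)) MeasureTheory.volume 0 1 := fun y s => by
    have := hhc y
    exact Continuous.intervalIntegrable (by fun_prop) _ _
  have hT0 : ∀ y s, 0 ≤ T y s := fun y s => by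
    rw [hT]
    refine intervalIntegral.integral_nonneg zero_le_one fun v hv => ?_
    have h1 := hv.1
    have h2 := s.2.1
    have h3 := hk0 (s * v)
    simp only [h]
    positivity
  have hTR : ∀ y s, T y s ≤ R := fun y s => by
    rw [hT]
    calc ∫ v in (0 : ℝ)..1, v ^ r * h y (s * v)
        ≤ ∫ v in (0 : ℝ)..1, (v ^ r + r * κ * R ^ 2 * v ^ (r + 1)) := by
          refine intervalIntegral.integral_mono_on zero_le_one (hicont y s)
            (Continuous.intervalIntegrable (by fun_prop) _ _) fun v hv => ?_
          have h1 := hv.1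
          have h2 := s.2.1
          have h3 := hk0 (s * v)
          have h4 : (s : ℝ) * v ≤ v := mul_le_of_le_one_left h1 s.2.2
          have h5 : r * k (s * v) * (s * v) * φ (IccExtend zero_le_one y (s * v)) ^ 2
              ≤ r * κ * v * R ^ 2 := by
            gcongr
            · exact hkκ _
            · exact hφR _
          rw [Real.rpow_add_one' h1 (by linarith)]
          have := mul_le_mul_of_nonneg_left h5 (Real.rpow_nonneg h1 r)
          simp only [h]
          linarith
      _ = 1 / (r + 1) + r * κ * R ^ 2 / (r + 2) := by
          rw [intervalIntegral.integral_add (hpow.intervalIntegrable _ _)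
            (Continuous.intervalIntegrable (by fun_prop) _ _),
            intervalIntegral.integral_const_mul, hint, hint']
          ring
      _ ≤ R := hmaps
  have hC0 : 0 ≤ 2 * r * κ * R / (r + 2) := by positivity
  have hlip : LipschitzWith ⟨_, hC0⟩ T := by
    refine LipschitzWith.of_dist_le_mul fun y z => ?_
    refine (ContinuousMap.dist_le (by positivity)).2 fun s => ?_
    rw [Real.dist_eq, hT, hT, ← intervalIntegral.integral_sub (hicont y s) (hicont z s)]
    have key : ∀ v ∈ Ioc (0 : ℝ) 1, ‖v ^ r * h y (s * v) - v ^ r * h z (s * v)‖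
        ≤ r * κ * (2 * R * dist y z) * v ^ (r + 1) := fun v hv => by
      have h1 := hv.1.le
      have h2 := s.2.1
      have h3 := hk0 (s * v)
      have h4 : (s : ℝ) * v ≤ v := mul_le_of_le_one_left h1 s.2.2
      set a := IccExtend zero_le_one y (s * v) with ha
      set b := IccExtend zero_le_one z (s * v) with hb
      have h6 : |a - b| ≤ dist y z := ContinuousMap.dist_apply_le_dist (f := y) (g := z) _
      have h7 : |φ a ^ 2 - φ b ^ 2| ≤ 2 * R * dist y z := by
        rw [sq_sub_sq, abs_mul]
        gcongr
        · rw [abs_of_nonneg (add_nonneg (hφ0 a) (hφ0 b))]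
          linarith [hφR a, hφR b]
        · exact (hφlip a b).trans h6
      have h8 : v ^ r * h y (s * v) - v ^ r * h z (s * v)
          = v ^ r * (r * k (s * v) * (s * v)) * (φ a ^ 2 - φ b ^ 2) := by
        simp only [h, ← ha, ← hb]; ring
      rw [h8, Real.norm_eq_abs, abs_mul, abs_of_nonneg (by positivity),
        Real.rpow_add_one' h1 (by linarith)]
      calc v ^ r * (r * k (s * v) * (s * v)) * |φ a ^ 2 - φ b ^ 2|
          ≤ v ^ r * (r * κ * v) * (2 * R * dist y z) := by
            gcongr
            exact hkκ _
        _ = _ := by ring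
    have := intervalIntegral.norm_integral_le_of_norm_le (μ := MeasureTheory.volume)
      zero_le_one (MeasureTheory.ae_of_all _ key)
      (Continuous.intervalIntegrable (by fun_prop) _ _)
    rw [intervalIntegral.integral_const_mul, hint'] at this
    refine this.trans (le_of_eq ?_)
    change _ = 2 * r * κ * R / (r + 2) * dist y z
    ring
  have hcw : ContractingWith ⟨_, hC0⟩ T := ⟨by exact_mod_cast hcontr, hlip⟩
  obtain ⟨y, hy, -⟩ := hcw.exists_fixedPoint 0 (edist_ne_top _ _)
  have hyT : ∀ s, y s = T y s := fun s => by rw [hy.eq]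
  have hext : ∀ s : Icc (0 : ℝ) 1, 0 ≤ y s ∧ y s ≤ R := fun s => by
    rw [hyT]; exact ⟨hT0 y s, hTR y s⟩
  refine ⟨IccExtend zero_le_one y, y.continuous.Icc_extend', fun s _ => hext _, fun s hs => ?_⟩
  rw [IccExtend_of_mem _ _ hs, hyT, hT]
  refine intervalIntegral.integral_congr fun v _ => ?_
  simp only [h]
  rw [hφid (IccExtend zero_le_one y (s * v)) (hext _).1 (hext _).2]

open Set Filter Topology in
/-- Nonnegative solutions of the singular Riccati terminal value problem are unique. -/
theorem riccati_terminal_unique {r M : ℝ} {k A A' B B' : ℝ → ℝ} (hr : 0 < r)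
    (hk : ∀ t ∈ Icc (0 : ℝ) 1, 0 ≤ k t ∧ k t ≤ M)
    (hA : ContinuousOn A (Icc 0 1)) (hA0 : ∀ t ∈ Icc (0 : ℝ) 1, 0 ≤ A t) (hA1 : A 1 = 0)
    (hAd : ∀ t ∈ Ico (0 : ℝ) 1, HasDerivWithinAt A (A' t) (Icc 0 1) t)
    (hAe : ∀ t ∈ Ico (0 : ℝ) 1, -A' t = r / (1 - t) * (-A t + k t * A t ^ 2) + 1)
    (hB : ContinuousOn B (Icc 0 1)) (hB0 : ∀ t ∈ Icc (0 : ℝ) 1, 0 ≤ B t) (hB1 : B 1 = 0)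
    (hBd : ∀ t ∈ Ico (0 : ℝ) 1, HasDerivWithinAt B (B' t) (Icc 0 1) t)
    (hBe : ∀ t ∈ Ico (0 : ℝ) 1, -B' t = r / (1 - t) * (-B t + k t * B t ^ 2) + 1) :
    ∀ t ∈ Icc (0 : ℝ) 1, B t = A t := by
  have hAB : ContinuousOn (fun t => M * (A t + B t)) (Icc 0 1) := by fun_prop
  have h1mem : (1 : ℝ) ∈ Icc (0 : ℝ) 1 := by simp
  obtain ⟨N, hN⟩ := isCompact_Icc.bddAbove_image hAB
  have hN' : ∀ t ∈ Icc (0 : ℝ) 1, M * (A t + B t) ≤ N := fun t ht => hN ⟨t, ht, rfl⟩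
  have hN0 : 0 ≤ N := by simpa [hA1, hB1] using hN' 1 h1mem
  obtain ⟨ε, hε, hnear⟩ : ∃ ε > 0, ∀ t ∈ Icc (0 : ℝ) 1, 1 - t < ε → M * (A t + B t) < 1 := by
    have h0 : M * (A 1 + B 1) < 1 := by simp [hA1, hB1]
    have := (hAB 1 h1mem).eventually (gt_mem_nhds h0)
    rw [eventually_nhdsWithin_iff, Metric.eventually_nhds_iff] at this
    obtain ⟨ε, hε, H⟩ := this
    refine ⟨ε, hε, fun t ht hlt => H ?_ ht⟩
    rw [Real.dist_eq, abs_sub_comm, abs_of_nonneg (by linarith [ht.2])]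
    exact hlt
  have hq : ∀ t ∈ Ico (0 : ℝ) 1,
      0 ≤ r / (1 - t) * (1 - k t * (A t + B t)) + r / ε * N := fun t ht => by
    have htI := Ico_subset_Icc_self ht
    have hpos : 0 < 1 - t := by linarith [ht.2]
    have hle : k t * (A t + B t) ≤ M * (A t + B t) :=
      mul_le_mul_of_nonneg_right (hk t htI).2 (add_nonneg (hA0 t htI) (hB0 t htI))
    have hrN : 0 ≤ r / ε * N := by positivity
    rcases lt_or_ge (1 - t) ε with hlt | hge
    · have := hnear t htI hlt
      have : 0 ≤ r / (1 - t) * (1 - k t * (A t + B t)) :=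
        mul_nonneg (by positivity) (by linarith)
      linarith
    · have h1 : r / (1 - t) * (k t * (A t + B t)) ≤ r / ε * N := by
        have := mul_nonneg (hk t htI).1 (add_nonneg (hA0 t htI) (hB0 t htI))
        gcongr
        exact hle.trans (hN' t htI)
      have h2 : 0 ≤ r / (1 - t) := by positivity
      linarith
  set C := 2 * (r / ε * N) with hC
  have hmono : MonotoneOn (fun t => (A t - B t) ^ 2 * Real.exp (C * t)) (Icc 0 1) := by
    have hder : ∀ t ∈ Ioo (0 : ℝ) 1, HasDerivAt (fun t => (A t - B t) ^ 2 * Real.exp (C * t))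
        (2 * (r / (1 - t) * (1 - k t * (A t + B t)) + r / ε * N) * (A t - B t) ^ 2
          * Real.exp (C * t)) t := fun t ht => by
      have htI := Ioo_subset_Ico_self ht
      have hn : Icc (0 : ℝ) 1 ∈ 𝓝 t := Icc_mem_nhds ht.1 ht.2
      have hd := (((hAd t htI).hasDerivAt hn).sub ((hBd t htI).hasDerivAt hn)).pow 2
      have he : HasDerivAt (fun t => Real.exp (C * t)) (Real.exp (C * t) * C) t := by
        simpa using ((hasDerivAt_id t).const_mul C).exp
      refine (hd.mul he).congr_deriv ?_
      have e1 := hAe t htI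
      have e2 := hBe t htI
      have e3 : A' t - B' t = r / (1 - t) * (1 - k t * (A t + B t)) * (A t - B t) := by
        linear_combination e2 - e1
      simp only [Pi.sub_apply, Pi.pow_apply, e3, hC]
      push_cast
      ring
    refine monotoneOn_of_deriv_nonneg (convex_Icc 0 1) (by fun_prop) ?_ ?_
    · rw [interior_Icc]
      exact fun t ht => (hder t ht).differentiableAt.differentiableWithinAt
    · rw [interior_Icc]
      intro t ht
      rw [(hder t ht).deriv]
      have := hq t (Ioo_subset_Ico_self ht)
      positivity
  intro t ht
  have h1 := hmono ht h1mem ht.2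
  simp only [hA1, hB1, sub_self, ne_eq, OfNat.ofNat_ne_zero, not_false_eq_true, zero_pow,
    zero_mul] at h1
  have h2 : (A t - B t) ^ 2 ≤ 0 := nonpos_of_mul_nonpos_left h1 (Real.exp_pos _)
  have h3 := pow_eq_zero_iff (two_ne_zero) |>.1 (le_antisymm h2 (sq_nonneg _))
  linarith

open Set in
/-- Existence for the singular Riccati terminal value problem, with a linear upper bound. -/
theorem exists_riccati_terminal {r κ R : ℝ} {k : ℝ → ℝ} (hr : 0 < r)
    (hk : ContinuousOn k (Icc 0 1)) (hkκ : ∀ x ∈ Icc (0 : ℝ) 1, 0 ≤ k x ∧ k x ≤ κ) (hR : 0 ≤ R)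
    (hmaps : 1 / (r + 1) + r * κ * R ^ 2 / (r + 2) ≤ R)
    (hcontr : 2 * r * κ * R / (r + 2) < 1) :
    ∃ A A' : ℝ → ℝ, ContinuousOn A (Icc 0 1) ∧
      (∀ t ∈ Icc (0 : ℝ) 1, 0 ≤ A t ∧ A t ≤ R * (1 - t)) ∧ A 1 = 0 ∧
      (∀ t ∈ Ico (0 : ℝ) 1, HasDerivWithinAt A (A' t) (Icc 0 1) t) ∧
      ContinuousOn A' (Ico 0 1) ∧
      ∀ t ∈ Ico (0 : ℝ) 1, -A' t = r / (1 - t) * (-A t + k t * A t ^ 2) + 1 := by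
  let K : ℝ → ℝ := fun x => IccExtend zero_le_one ((Icc (0 : ℝ) 1).domRestrict k) (1 - x)
  have hKc : Continuous K :=
    (hk.domRestrict.Icc_extend' (h := zero_le_one)).comp (continuous_const.sub continuous_id)
  have hKk : ∀ t ∈ Icc (0 : ℝ) 1, K (1 - t) = k t := fun t ht => by
    simp only [K, sub_sub_cancel]
    rw [IccExtend_of_mem _ _ ht]; rfl
  obtain ⟨y, hyc, hyR, hy⟩ := exists_continuous_eq_integral_rpow_mul (k := K) hr hKc
    (fun x => (hkκ _ (projIcc (0 : ℝ) 1 zero_le_one (1 - x)).2).1)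
    (fun x => (hkκ _ (projIcc (0 : ℝ) 1 zero_le_one (1 - x)).2).2) hR hmaps hcontr
  have hpow : Continuous fun v : ℝ => v ^ r := Real.continuous_rpow_const hr.le
  let g : ℝ → ℝ := fun u => u ^ r * (1 + r * K u * u * y u ^ 2)
  have hg : Continuous g := by fun_prop
  have hG : ∀ s, HasDerivAt (fun s => ∫ u in (0 : ℝ)..s, g u) (g s) s := fun s =>
    intervalIntegral.integral_hasDerivAt_right (hg.intervalIntegrable _ _)
      (hg.stronglyMeasurableAtFilter _ _) hg.continuousAt
  have hys : ∀ s ∈ Icc (0 : ℝ) 1, s * y s = s ^ (-r) * ∫ u in (0 : ℝ)..s, g u := fun s hs => by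
    rcases hs.1.eq_or_lt with rfl | hpos
    · simp
    have h1 : ∫ u in (0 : ℝ)..s, g u = s * ∫ v in (0 : ℝ)..1, g (s * v) := by
      rw [intervalIntegral.mul_integral_comp_mul_left]
      simp
    have h2 : ∫ v in (0 : ℝ)..1, g (s * v) = s ^ r * y s := by
      rw [hy s hs, ← intervalIntegral.integral_const_mul]
      refine intervalIntegral.integral_congr fun v hv => ?_
      rw [uIcc_of_le zero_le_one] at hv
      simp only [g]
      rw [Real.mul_rpow hpos.le hv.1]
      ring
    rw [h1, h2, Real.rpow_neg hpos.le]
    have := (Real.rpow_pos_of_pos hpos r).ne'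
    field_simp
  have hflip : ∀ t ∈ Icc (0 : ℝ) 1, 1 - t ∈ Icc (0 : ℝ) 1 := fun t ht =>
    ⟨by linarith [ht.2], by linarith [ht.1]⟩
  let A : ℝ → ℝ := fun t => (1 - t) * y (1 - t)
  have hAc : Continuous A := by fun_prop
  refine ⟨A, fun t => -(r / (1 - t) * (-A t + k t * A t ^ 2) + 1), hAc.continuousOn,
    fun t ht => ?_, by simp [A], fun t ht => ?_, ?_, fun t _ => by ring⟩
  · obtain ⟨h0, h1⟩ := hflip t ht
    obtain ⟨h2, h3⟩ := hyR _ (hflip t ht)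
    exact ⟨mul_nonneg h0 h2, by simp only [A]; nlinarith⟩
  · have htI := Ico_subset_Icc_self ht
    have hpos : 0 < 1 - t := by linarith [ht.2]
    have hd : HasDerivAt (fun s => s ^ (-r) * ∫ u in (0 : ℝ)..s, g u)
        (r / (1 - t) * (-A t + k t * A t ^ 2) + 1) (1 - t) := by
      refine ((Real.hasDerivAt_rpow_const (Or.inl hpos.ne')).mul (hG (1 - t))).congr_deriv ?_
      have h1 := hys _ (hflip t htI)
      have h2 : (1 - t) ^ (-r) * g (1 - t)
          = 1 + r * k t * (1 - t) * y (1 - t) ^ 2 := by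
        simp only [g]
        rw [← mul_assoc, ← Real.rpow_add hpos, neg_add_cancel, Real.rpow_zero, one_mul,
          hKk t htI]
      rw [h2, Real.rpow_sub_one hpos.ne']
      have h3 : -r * ((1 - t) ^ (-r) / (1 - t)) * (∫ u in (0 : ℝ)..(1 - t), g u)
          = -r / (1 - t) * A t := by
        simp only [A]; rw [h1]; ring
      rw [h3]
      simp only [A]
      field_simp
      ring
    have hd' : HasDerivAt (fun t => (1 - t) ^ (-r) * ∫ u in (0 : ℝ)..(1 - t), g u)
        (-(r / (1 - t) * (-A t + k t * A t ^ 2) + 1)) t := by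
      simpa using hd.comp_const_sub 1 t
    exact hd'.hasDerivWithinAt.congr (fun x hx => hys _ (hflip x hx)) (hys _ (hflip t htI))
  · have hk' := hk.mono (Ico_subset_Icc_self : Ico (0 : ℝ) 1 ⊆ Icc 0 1)
    have hA' := hAc.continuousOn (s := Ico (0 : ℝ) 1)
    have : ∀ t ∈ Ico (0 : ℝ) 1, 1 - t ≠ 0 := fun t ht => by linarith [ht.2]
    fun_prop (disch := assumption)


/-- Existence, uniqueness and bounds for the terminal value problem (16):
`−A′(t) = (r/(1−t))·(−A(t) + (σ(t)²ψ/2)·A(t)²) + 1` on `[0,1)`, `A(1) = 0`,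
with `A` nonnegative, continuous on `[0,1]` and continuously differentiable on `[0,1)`. -/
theorem stmt_12 (r ψ σbar : ℝ) (hr : 0 < r) (hψ : 0 < ψ) (hσ : 0 < σbar)
    (hsmall : σbar ^ 2 * ψ < r / 2)
    (σ : ℝ → ℝ) (hσc : ContinuousOn σ (Set.Icc 0 1))
    (hσb : ∀ t ∈ Set.Icc (0:ℝ) 1, 0 < σ t ∧ σ t ≤ σbar) :
    ∃ A A' : ℝ → ℝ,
      (ContinuousOn A (Set.Icc 0 1) ∧ (∀ t ∈ Set.Icc (0:ℝ) 1, 0 ≤ A t) ∧ A 1 = 0 ∧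
        (∀ t ∈ Set.Ico (0:ℝ) 1, HasDerivWithinAt A (A' t) (Set.Icc 0 1) t) ∧
        ContinuousOn A' (Set.Ico 0 1) ∧
        (∀ t ∈ Set.Ico (0:ℝ) 1,
          -A' t = r / (1 - t) * (-A t + (σ t) ^ 2 * ψ / 2 * (A t) ^ 2) + 1)) ∧
      (∀ B B' : ℝ → ℝ,
        ContinuousOn B (Set.Icc 0 1) → (∀ t ∈ Set.Icc (0:ℝ) 1, 0 ≤ B t) → B 1 = 0 →
        (∀ t ∈ Set.Ico (0:ℝ) 1, HasDerivWithinAt B (B' t) (Set.Icc 0 1) t) →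
        ContinuousOn B' (Set.Ico 0 1) →
        (∀ t ∈ Set.Ico (0:ℝ) 1,
          -B' t = r / (1 - t) * (-B t + (σ t) ^ 2 * ψ / 2 * (B t) ^ 2) + 1) →
        ∀ t ∈ Set.Icc (0:ℝ) 1, B t = A t) ∧
      ∀ Ybar : ℝ, 0 < Ybar →
        r / ((r + 1) * (r + 2)) * (σbar ^ 2 * ψ) * (Ybar + 1) < 1 →
        r / (2 * (r + 1) * (r + 2)) * (σbar ^ 2 * ψ) * (Ybar + 1) ^ 2 < Ybar →
        ∀ t ∈ Set.Icc (0:ℝ) 1, 0 ≤ A t ∧ A t ≤ (1 + Ybar) * (1 - t) / (1 + r) := by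
  have hκ : ∀ t ∈ Set.Icc (0 : ℝ) 1,
      0 ≤ σ t ^ 2 * ψ / 2 ∧ σ t ^ 2 * ψ / 2 ≤ σbar ^ 2 * ψ / 2 := fun t ht => by
    obtain ⟨h0, h1⟩ := hσb t ht
    exact ⟨by positivity, by gcongr⟩
  have hkc : ContinuousOn (fun t => σ t ^ 2 * ψ / 2) (Set.Icc 0 1) := by fun_prop
  have hex : ∀ Y : ℝ, 0 < Y → r / ((r + 1) * (r + 2)) * (σbar ^ 2 * ψ) * (Y + 1) < 1 →
      r / (2 * (r + 1) * (r + 2)) * (σbar ^ 2 * ψ) * (Y + 1) ^ 2 < Y → _ :=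
    fun Y hY h1 h2 => exists_riccati_terminal (R := (1 + Y) / (1 + r)) hr hkc hκ (by positivity)
      (by
        have h3 : 1 / (r + 1) + r * (σbar ^ 2 * ψ / 2) * ((1 + Y) / (1 + r)) ^ 2 / (r + 2)
            = (1 + r / (2 * (r + 1) * (r + 2)) * (σbar ^ 2 * ψ) * (Y + 1) ^ 2) / (1 + r) := by
          field_simp
          ring
        rw [h3]
        gcongr)
      (by
        refine lt_of_eq_of_lt ?_ h1
        field_simp
        ring)
  obtain ⟨A, A', hA, hAb, hA1, hAd, hA', hAe⟩ := hex 1 one_pos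
    (by
      rw [div_mul_eq_mul_div, div_mul_eq_mul_div, div_lt_one (by positivity)]
      nlinarith)
    (by
      rw [div_mul_eq_mul_div, div_mul_eq_mul_div, div_lt_one (by positivity)]
      nlinarith)
  have huniq := fun (B B' : ℝ → ℝ) hB hB0 hB1 hBd hBe =>
    riccati_terminal_unique (B := B) (B' := B') hr hκ hA (fun t ht => (hAb t ht).1) hA1 hAd hAe
      hB hB0 hB1 hBd hBe
  refine ⟨A, A', ⟨hA, fun t ht => (hAb t ht).1, hA1, hAd, hA', hAe⟩,
    fun B B' hB hB0 hB1 hBd _ hBe => huniq B B' hB hB0 hB1 hBd hBe, fun Y hY h1 h2 t ht => ?_⟩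
  obtain ⟨B, B', hB, hBb, hB1, hBd, -, hBe⟩ := hex Y hY h1 h2
  rw [← huniq B B' hB (fun t ht => (hBb t ht).1) hB1 hBd hBe t ht]
  exact ⟨(hBb t ht).1, (hBb t ht).2.trans_eq (by ring)⟩
end

section
/- Let r, ψ > 0, let σ, a : [0,1] → ℝ be continuous with σ(t) > 0 and a(t) > 0 for all t, and let A : [0,1] → ℝ be continuous on [0,1], continuously differentiable on [0,1), with A(1) = 0 and −A′(t) = (r/(1−t))·(−A(t) + (σ(t)²ψ/2)·A(t)²) + 1 for t ∈ [0,1). Define B(t) = ∫_t^1 a(s)·A(s) ds and H(t,x) = A(t)·x + B(t). Then for every t ∈ [0,1) and every x ≥ 0, H satisfies the Hamilton–Jacobi–Bellman equation −∂H/∂t(t,x) = (a(t) − (r/(1−t))·x)·∂H/∂x(t,x) + (1/2)·(r/(1−t))·σ(t)²·x·∂²H/∂x²(t,x) + (1/2)·σ(t)²·ψ·(r/(1−t))·x·(∂H/∂x(t,x))² + x. -/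
open MeasureTheory

/-- The integral of a function continuous on `[a, b]`, as a function of its lower endpoint,
is differentiable within `[a, b]`. -/
theorem ContinuousOn.hasDerivWithinAt_integral_left {f : ℝ → ℝ} {a b t : ℝ}
    (hf : ContinuousOn f (Set.Icc a b)) (ht : t ∈ Set.Icc a b) :
    HasDerivWithinAt (fun τ => ∫ s in τ..b, f s) (-f t) (Set.Icc a b) t := by
  have : Fact (t ∈ Set.Icc a b) := ⟨ht⟩
  refine intervalIntegral.integral_hasDerivWithinAt_left ?_
    (t := Set.Icc a b) ?_ (hf t ht)
  · exact (hf.mono (Set.Icc_subset_Icc_left ht.1)).intervalIntegrable_of_Icc ht.2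
  · exact hf.stronglyMeasurableAtFilter_nhdsWithin measurableSet_Icc t

/-- Verification that `H(t,x) = A(t)x + B(t)` with `B(t) = ∫_t^1 a(s)A(s) ds` solves the
HJB equation (51) on `[0,1) × [0,∞)`. -/
theorem stmt_14 (r ψ : ℝ) (hr : 0 < r) (hψ : 0 < ψ)
    (σ a : ℝ → ℝ) (hσc : ContinuousOn σ (Set.Icc 0 1)) (hac : ContinuousOn a (Set.Icc 0 1))
    (hσpos : ∀ t ∈ Set.Icc (0:ℝ) 1, 0 < σ t) (hapos : ∀ t ∈ Set.Icc (0:ℝ) 1, 0 < a t)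
    (A A' : ℝ → ℝ) (hAc : ContinuousOn A (Set.Icc 0 1)) (hA1 : A 1 = 0)
    (hAderiv : ∀ t ∈ Set.Ico (0:ℝ) 1, HasDerivWithinAt A (A' t) (Set.Icc 0 1) t)
    (hA'c : ContinuousOn A' (Set.Ico 0 1))
    (hAode : ∀ t ∈ Set.Ico (0:ℝ) 1,
      -A' t = r / (1 - t) * (-A t + (σ t) ^ 2 * ψ / 2 * (A t) ^ 2) + 1)
    (H : ℝ → ℝ → ℝ)
    (hH : ∀ t x : ℝ, H t x = A t * x + ∫ s in t..(1:ℝ), a s * A s) :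
    ∀ t ∈ Set.Ico (0:ℝ) 1, ∀ x : ℝ, 0 ≤ x →
      ∃ Ht Hx Hxx : ℝ,
        HasDerivWithinAt (fun τ => H τ x) Ht (Set.Icc 0 1) t ∧
        HasDerivAt (fun ξ => H t ξ) Hx x ∧
        HasDerivAt (deriv (fun ξ => H t ξ)) Hxx x ∧
        -Ht = (a t - r / (1 - t) * x) * Hx + 1 / 2 * (r / (1 - t)) * (σ t) ^ 2 * x * Hxx +
          1 / 2 * (σ t) ^ 2 * ψ * (r / (1 - t)) * x * Hx ^ 2 + x := by
  intro t ht x _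
  have htc : t ∈ Set.Icc (0:ℝ) 1 := Set.Ico_subset_Icc_self ht
  have hx : ∀ y : ℝ, HasDerivAt (fun ξ => H t ξ) (A t) y := fun y => by
    simpa [hH] using ((hasDerivAt_id y).const_mul (A t)).add_const (∫ s in t..(1:ℝ), a s * A s)
  have hd : deriv (fun ξ => H t ξ) = fun _ => A t := funext fun y => (hx y).deriv
  refine ⟨A' t * x + -(a t * A t), A t, 0, ?_, hx x, ?_, ?_⟩
  · simp only [hH]
    exact ((hAderiv t ht).mul_const x).add
      ((hac.mul hAc).hasDerivWithinAt_integral_left htc)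
  · rw [hd]
    exact hasDerivAt_const x (A t)
  · linear_combination x * hAode t ht
end

section
/- Let r, ψ, σ̄ be positive real numbers with σ̄²ψ < r/2, set Q = r·σ̄²ψ/((r+1)(r+2)), let Ȳ > 0 satisfy (r/(2(r+1)²))·σ̄²ψ·(Ȳ+1)² < 1, let W̄ satisfy (1/Q)·(1 − √(1 − 2(r+1)·Q/(r+2))) < W̄ < 1/Q, let ω : [0,1] → ℝ be continuous with 0 < ω(s) ≤ σ̄, and let Y : [0,1] → ℝ be continuous with 0 ≤ Y(s) ≤ Ȳ for all s. Then there exists a unique continuous function W : [0,1] → ℝ with W(0) = 0 such that W(s) = (r·ψ/(2(r+1)))·s^{−(r+1)}·∫₀^s m^{r+1}·ω(m)²·(W(m)² + (1+Y(m))²) dm for all s ∈ (0,1] and 0 ≤ W(s) < W̄ for all s ∈ [0,1]. -/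
open MeasureTheory

/-- The rescaled weighted average `s ∫₀¹ t^p f(st) dt`, equal to `s^{-p} ∫₀^s m^p f(m) dm` for
`s > 0`. -/
noncomputable def rpowAverage (p : ℝ) (f : ℝ → ℝ) (s : ℝ) : ℝ :=
  s * ∫ t in (0:ℝ)..1, t ^ p * f (s * t)

lemma rpowAverage_eq {p : ℝ} (f : ℝ → ℝ) {s : ℝ} (hs : 0 < s) :
    rpowAverage p f s = s ^ (-p) * ∫ m in (0:ℝ)..s, m ^ p * f m := by
  have h := intervalIntegral.smul_integral_comp_mul_left (a := 0) (b := 1)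
    (fun m => m ^ p * f m) s
  have h2 : ∫ t in (0:ℝ)..1, (s * t) ^ p * f (s * t) =
      s ^ p * ∫ t in (0:ℝ)..1, t ^ p * f (s * t) := by
    rw [← intervalIntegral.integral_const_mul]
    refine intervalIntegral.integral_congr fun t ht => ?_
    rw [Set.uIcc_of_le zero_le_one] at ht
    rw [Real.mul_rpow hs.le ht.1, mul_assoc]
  simp only [mul_zero, mul_one, smul_eq_mul] at h
  rw [← h, h2, rpowAverage, Real.rpow_neg hs.le]
  field_simp [(Real.rpow_pos_of_pos hs p).ne']

lemma continuous_rpowAverage {p : ℝ} (hp : 0 ≤ p) {f : ℝ → ℝ} (hf : Continuous f) :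
    Continuous (rpowAverage p f) := by
  refine continuous_id.mul
    (intervalIntegral.continuous_parametric_intervalIntegral_of_continuous' ?_ 0 1)
  exact ((Real.continuous_rpow_const hp).comp continuous_snd).mul
    (hf.comp (continuous_fst.mul continuous_snd))

lemma intervalIntegrable_rpow_mul_comp {p : ℝ} (hp : 0 ≤ p) {f : ℝ → ℝ} (hf : Continuous f)
    (s : ℝ) : IntervalIntegrable (fun t => t ^ p * f (s * t)) volume 0 1 :=
  ((Real.continuous_rpow_const hp).mul (hf.comp (continuous_const.mul continuous_id))
    ).intervalIntegrable 0 1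

lemma rpowAverage_sub {p : ℝ} (hp : 0 ≤ p) {f g : ℝ → ℝ} (hf : Continuous f)
    (hg : Continuous g) (s : ℝ) :
    rpowAverage p (fun x => f x - g x) s = rpowAverage p f s - rpowAverage p g s := by
  simp only [rpowAverage, mul_sub]
  rw [intervalIntegral.integral_sub (intervalIntegrable_rpow_mul_comp hp hf s)
    (intervalIntegrable_rpow_mul_comp hp hg s), mul_sub]

lemma rpowAverage_nonneg {p : ℝ} {f : ℝ → ℝ} (h : ∀ x, 0 ≤ f x) {s : ℝ} (hs : 0 ≤ s) :
    0 ≤ rpowAverage p f s :=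
  mul_nonneg hs (intervalIntegral.integral_nonneg zero_le_one fun _ ht =>
    mul_nonneg (Real.rpow_nonneg ht.1 p) (h _))

lemma abs_rpowAverage_le {p : ℝ} (hp : 0 ≤ p) {f : ℝ → ℝ} {M : ℝ} (hM : ∀ x, |f x| ≤ M)
    {s : ℝ} (hs : s ∈ Set.Icc (0:ℝ) 1) : |rpowAverage p f s| ≤ M / (p + 1) := by
  have hM0 : 0 ≤ M := (abs_nonneg _).trans (hM 0)
  have hint : |∫ t in (0:ℝ)..1, t ^ p * f (s * t)| ≤ ∫ t in (0:ℝ)..1, t ^ p * M := by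
    rw [← Real.norm_eq_abs]
    refine intervalIntegral.norm_integral_le_of_norm_le zero_le_one
      (Filter.Eventually.of_forall fun t ht => ?_)
      (((Real.continuous_rpow_const hp).mul continuous_const).intervalIntegrable 0 1)
    rw [Real.norm_eq_abs, abs_mul, abs_of_nonneg (Real.rpow_nonneg ht.1.le p)]
    exact mul_le_mul_of_nonneg_left (hM _) (Real.rpow_nonneg ht.1.le p)
  have hval : ∫ t in (0:ℝ)..1, t ^ p * M = M / (p + 1) := by
    rw [intervalIntegral.integral_mul_const, integral_rpow (Or.inl (by linarith)),
      Real.one_rpow, Real.zero_rpow (by linarith)]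
    ring
  rw [rpowAverage, abs_mul, abs_of_nonneg hs.1]
  calc s * |∫ t in (0:ℝ)..1, t ^ p * f (s * t)| ≤ 1 * (M / (p + 1)) :=
        mul_le_mul hs.2 (hint.trans hval.le) (abs_nonneg _) zero_le_one
    _ = M / (p + 1) := one_mul _

lemma abs_clamp_sq_sub_clamp_sq_le {M : ℝ} (hM : 0 ≤ M) (x y : ℝ) :
    |(max 0 (min x M)) ^ 2 - (max 0 (min y M)) ^ 2| ≤ 2 * M * |x - y| := by
  have h : ∀ z : ℝ, 0 ≤ max 0 (min z M) ∧ max 0 (min z M) ≤ M := fun z =>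
    ⟨le_max_left _ _, max_le hM (min_le_right _ _)⟩
  have hd : |max 0 (min x M) - max 0 (min y M)| ≤ |x - y| := by
    rw [max_comm 0, max_comm 0]
    exact (abs_max_sub_max_le_abs _ _ _).trans (by
      have := abs_min_sub_min_le_max x M y M
      simpa using this)
  obtain ⟨hx0, hx⟩ := h x
  obtain ⟨hy0, hy⟩ := h y
  rw [sq_sub_sq, abs_mul, abs_of_nonneg (add_nonneg hx0 hy0)]
  exact mul_le_mul (by linarith) hd (abs_nonneg _) (by linarith)

/-- A truncated quadratic fixed-point equation for the weighted average has exactly one continuous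
solution on `[0,1]` when the truncated operator is a contraction. -/
theorem existsUnique_fixedPoint_rpowAverage_clamp {p c a M : ℝ} (hp : 0 ≤ p) (hc : 0 ≤ c)
    (hM : 0 ≤ M) {A B : ℝ → ℝ} (hA : Continuous A) (hB : Continuous B)
    (hAa : ∀ x, |A x| ≤ a) (hcontr : c * (a * (2 * M) / (p + 1)) < 1) :
    ∃! g : C(Set.Icc (0:ℝ) 1, ℝ), ∀ s : Set.Icc (0:ℝ) 1,
      g s = c * rpowAverage p (fun x => A x *
        ((max 0 (min (g (Set.projIcc 0 1 zero_le_one x)) M)) ^ 2 + B x)) s := by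
  have ha : 0 ≤ a := (abs_nonneg _).trans (hAa 0)
  have hF : ∀ g : C(Set.Icc (0:ℝ) 1, ℝ), Continuous (fun x => A x *
        ((max 0 (min (g (Set.projIcc 0 1 zero_le_one x)) M)) ^ 2 + B x)) := fun g =>
    hA.mul (((continuous_const.max
      ((g.continuous.comp continuous_projIcc).min continuous_const)).pow 2).add hB)
  let T : C(Set.Icc (0:ℝ) 1, ℝ) → C(Set.Icc (0:ℝ) 1, ℝ) := fun g =>
    ⟨fun s => c * rpowAverage p (fun x => A x *
        ((max 0 (min (g (Set.projIcc 0 1 zero_le_one x)) M)) ^ 2 + B x)) s,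
      continuous_const.mul ((continuous_rpowAverage hp (hF g)).comp continuous_subtype_val)⟩
  have hK : 0 ≤ c * (a * (2 * M) / (p + 1)) := by positivity
  have hT : ContractingWith ⟨c * (a * (2 * M) / (p + 1)), hK⟩ T := by
    refine ⟨by exact_mod_cast hcontr, LipschitzWith.of_dist_le_mul fun g h => ?_⟩
    rw [ContinuousMap.dist_le (by positivity)]
    intro s
    have hb : ∀ x, |A x * ((max 0 (min (g (Set.projIcc 0 1 zero_le_one x)) M)) ^ 2 + B x) -
        A x * ((max 0 (min (h (Set.projIcc 0 1 zero_le_one x)) M)) ^ 2 + B x)| ≤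
        a * (2 * M * dist g h) := by
      intro x
      rw [← mul_sub, add_sub_add_right_eq_sub, abs_mul]
      refine mul_le_mul (hAa x) ((abs_clamp_sq_sub_clamp_sq_le hM _ _).trans ?_)
        (abs_nonneg _) ha
      exact mul_le_mul_of_nonneg_left ((Real.dist_eq _ _).symm.trans_le (ContinuousMap.dist_apply_le_dist _))
        (by positivity)
    have h1 := abs_rpowAverage_le hp hb s.2
    rw [rpowAverage_sub hp (hF g) (hF h)] at h1
    calc dist (T g s) (T h s) = |c * (_ - _)| := by rw [Real.dist_eq, mul_sub]; rfl
      _ = c * |_ - _| := by rw [abs_mul, abs_of_nonneg hc]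
      _ ≤ c * (a * (2 * M * dist g h) / (p + 1)) := mul_le_mul_of_nonneg_left h1 hc
      _ = c * (a * (2 * M) / (p + 1)) * dist g h := by ring
  refine ⟨hT.fixedPoint T, fun s => ?_, fun g hg => hT.fixedPoint_unique ?_⟩
  · exact (DFunLike.congr_fun hT.fixedPoint_isFixedPt s).symm
  · exact ContinuousMap.ext fun s => (hg s).symm

/-- Existence and uniqueness for the fixed-point problem (90):
`W(s) = (rψ/(2(r+1)))·s^{-(r+1)} ∫₀^s m^{r+1} ω(m)² (W(m)² + (1+Y(m))²) dm` on `(0,1]`,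
`W(0) = 0`, with `0 ≤ W < W̄`. -/
theorem stmt_16 (r ψ σ Ybar Wbar : ℝ) (hr : 0 < r) (hψ : 0 < ψ) (hσ : 0 < σ) (hY : 0 < Ybar)
    (hsmall : σ ^ 2 * ψ < r / 2)
    (Q : ℝ) (hQ : Q = r * (σ ^ 2 * ψ) / ((r + 1) * (r + 2)))
    (hYb : r / (2 * (r + 1) ^ 2) * (σ ^ 2 * ψ) * (Ybar + 1) ^ 2 < 1)
    (hW1 : 1 / Q * (1 - Real.sqrt (1 - 2 * (r + 1) * Q / (r + 2))) < Wbar)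
    (hW2 : Wbar < 1 / Q)
    (ω : ℝ → ℝ) (hω : ContinuousOn ω (Set.Icc 0 1))
    (hωb : ∀ s ∈ Set.Icc (0:ℝ) 1, 0 < ω s ∧ ω s ≤ σ)
    (Y : ℝ → ℝ) (hYc : ContinuousOn Y (Set.Icc 0 1))
    (hYr : ∀ s ∈ Set.Icc (0:ℝ) 1, 0 ≤ Y s ∧ Y s ≤ Ybar) :
    ∃ W : ℝ → ℝ, ContinuousOn W (Set.Icc 0 1) ∧ W 0 = 0 ∧
      (∀ s ∈ Set.Ioc (0:ℝ) 1,
        W s = r * ψ / (2 * (r + 1)) * s ^ (-(r + 1)) *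
          ∫ m in (0:ℝ)..s, m ^ (r + 1) * (ω m) ^ 2 * ((W m) ^ 2 + (1 + Y m) ^ 2)) ∧
      (∀ s ∈ Set.Icc (0:ℝ) 1, 0 ≤ W s ∧ W s < Wbar) ∧
      ∀ W' : ℝ → ℝ, ContinuousOn W' (Set.Icc 0 1) → W' 0 = 0 →
        (∀ s ∈ Set.Ioc (0:ℝ) 1,
          W' s = r * ψ / (2 * (r + 1)) * s ^ (-(r + 1)) *
            ∫ m in (0:ℝ)..s, m ^ (r + 1) * (ω m) ^ 2 * ((W' m) ^ 2 + (1 + Y m) ^ 2)) →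
        (∀ s ∈ Set.Icc (0:ℝ) 1, 0 ≤ W' s ∧ W' s < Wbar) →
        ∀ s ∈ Set.Icc (0:ℝ) 1, W' s = W s := by
  have hQpos : 0 < Q := by rw [hQ]; positivity
  have hroot : 1 - Real.sqrt (1 - 2 * (r + 1) * Q / (r + 2)) < Q * Wbar := by
    rw [one_div, inv_mul_lt_iff₀ hQpos] at hW1
    exact hW1
  have hQW : Q * Wbar < 1 := by
    rw [lt_div_iff₀ hQpos] at hW2
    linarith
  have hWpos : 0 < Wbar := by
    have : Real.sqrt (1 - 2 * (r + 1) * Q / (r + 2)) ≤ 1 := by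
      rw [Real.sqrt_le_one]
      have : 0 ≤ 2 * (r + 1) * Q / (r + 2) := by positivity
      linarith
    by_contra hneg
    nlinarith
  have hquad : Q / 2 * Wbar ^ 2 + (r + 1) / (r + 2) < Wbar := by
    have h1 : (1 - Q * Wbar) ^ 2 < 1 - 2 * (r + 1) * Q / (r + 2) :=
      (Real.lt_sqrt (by linarith)).1 (by linarith)
    have h2 : 2 * (r + 1) * Q / (r + 2) = 2 * Q * ((r + 1) / (r + 2)) := by ring
    rw [h2] at h1
    have h3 : 0 < 2 * Q * (Wbar - (Q / 2 * Wbar ^ 2 + (r + 1) / (r + 2))) := by linarith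
    have h4 := (mul_pos_iff_of_pos_left (by positivity)).1 h3
    linarith
  have hYQ : Q / 2 * (1 + Ybar) ^ 2 < (r + 1) / (r + 2) := by
    have : Q / 2 * (1 + Ybar) ^ 2 =
        (r + 1) / (r + 2) * (r / (2 * (r + 1) ^ 2) * (σ ^ 2 * ψ) * (Ybar + 1) ^ 2) := by
      rw [hQ]; field_simp; ring
    rw [this]
    exact mul_lt_of_lt_one_right (by positivity) hYb
  have hcQ : r * ψ / (2 * (r + 1)) * (σ ^ 2 / (r + 1 + 1)) = Q / 2 := by
    rw [hQ, show r + 1 + 1 = r + 2 by ring]; field_simp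
  set c := r * ψ / (2 * (r + 1)) with hc
  have hc0 : 0 ≤ c := by positivity
  have hp : 0 ≤ r + 1 := by positivity
  let A : ℝ → ℝ := fun x => (Set.IccExtend (zero_le_one' ℝ) (Set.domRestrict _ ω) x) ^ 2
  let B : ℝ → ℝ := fun x => (1 + Set.IccExtend (zero_le_one' ℝ) (Set.domRestrict _ Y) x) ^ 2
  have hA : Continuous A := (hω.domRestrict.Icc_extend').pow 2
  have hB : Continuous B := (continuous_const.add hYc.domRestrict.Icc_extend').pow 2
  have hA0 : ∀ x, 0 ≤ A x := fun x => sq_nonneg _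
  have hB0 : ∀ x, 0 ≤ B x := fun x => sq_nonneg _
  have hAσ : ∀ x, A x ≤ σ ^ 2 := fun x =>
    have h := hωb _ (Set.projIcc 0 1 zero_le_one x).2
    pow_le_pow_left₀ h.1.le h.2 2
  have hBY : ∀ x, B x ≤ (1 + Ybar) ^ 2 := fun x =>
    have h := hYr _ (Set.projIcc 0 1 zero_le_one x).2
    pow_le_pow_left₀ (add_nonneg zero_le_one h.1) (add_le_add_right h.2 1) 2
  have hAeq : ∀ x ∈ Set.Icc (0:ℝ) 1, A x = ω x ^ 2 := fun x hx => by
    simp only [A, Set.IccExtend_of_mem _ _ hx, Set.domRestrict_apply]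
  have hBeq : ∀ x ∈ Set.Icc (0:ℝ) 1, B x = (1 + Y x) ^ 2 := fun x hx => by
    simp only [B, Set.IccExtend_of_mem _ _ hx, Set.domRestrict_apply]
  have hcontr : c * (σ ^ 2 * (2 * Wbar) / (r + 1 + 1)) < 1 := by
    have : c * (σ ^ 2 * (2 * Wbar) / (r + 1 + 1)) =
      c * (σ ^ 2 / (r + 1 + 1)) * (2 * Wbar) := by ring
    rw [this, hcQ]
    linarith
  obtain ⟨g, hg, hguniq⟩ := existsUnique_fixedPoint_rpowAverage_clamp hp hc0 hWpos.le hA hB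
    (fun x => (abs_of_nonneg (hA0 x)).trans_le (hAσ x)) hcontr
  have hconv : ∀ (h : C(Set.Icc (0:ℝ) 1, ℝ)) (W : ℝ → ℝ),
      (∀ s : Set.Icc (0:ℝ) 1, h s = W s ∧ 0 ≤ W s ∧ W s < Wbar) → ∀ s ∈ Set.Ioc (0:ℝ) 1,
      c * rpowAverage (r + 1) (fun x => A x *
        ((max 0 (min (h (Set.projIcc 0 1 zero_le_one x)) Wbar)) ^ 2 + B x)) s =
      c * s ^ (-(r + 1)) *
        ∫ m in (0:ℝ)..s, m ^ (r + 1) * (ω m) ^ 2 * ((W m) ^ 2 + (1 + Y m) ^ 2) := by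
    intro h W hW s hs
    rw [rpowAverage_eq _ hs.1, ← mul_assoc]
    congr 1
    refine intervalIntegral.integral_congr fun m hm => ?_
    rw [Set.uIcc_of_le hs.1.le] at hm
    have hm1 : m ∈ Set.Icc (0:ℝ) 1 := ⟨hm.1, hm.2.trans hs.2⟩
    obtain ⟨e, e0, e1⟩ := hW ⟨m, hm1⟩
    simp only at e e0 e1 ⊢
    rw [hAeq m hm1, hBeq m hm1, Set.projIcc_of_mem _ hm1, e, min_eq_left e1.le,
      max_eq_right e0, mul_assoc]
  have hgb : ∀ s : Set.Icc (0:ℝ) 1, 0 ≤ g s ∧ g s < Wbar := by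
    intro s
    have h0 : ∀ x, 0 ≤ A x *
        ((max 0 (min (g (Set.projIcc 0 1 zero_le_one x)) Wbar)) ^ 2 + B x) := fun x =>
      mul_nonneg (hA0 x) (add_nonneg (sq_nonneg _) (hB0 x))
    have h1 : ∀ x, |A x *
        ((max 0 (min (g (Set.projIcc 0 1 zero_le_one x)) Wbar)) ^ 2 + B x)| ≤
        σ ^ 2 * (Wbar ^ 2 + (1 + Ybar) ^ 2) := fun x => by
      rw [abs_of_nonneg (h0 x)]
      refine mul_le_mul (hAσ x) (add_le_add ?_ (hBY x))
        (add_nonneg (sq_nonneg _) (hB0 x)) (sq_nonneg _)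
      exact pow_le_pow_left₀ (le_max_left _ _) (max_le hWpos.le (min_le_right _ _)) 2
    rw [hg s]
    refine ⟨mul_nonneg hc0 (rpowAverage_nonneg h0 s.2.1), ?_⟩
    calc _ ≤ c * (σ ^ 2 * (Wbar ^ 2 + (1 + Ybar) ^ 2) / (r + 1 + 1)) :=
          mul_le_mul_of_nonneg_left ((le_abs_self _).trans (abs_rpowAverage_le hp h1 s.2)) hc0
      _ = c * (σ ^ 2 / (r + 1 + 1)) * (Wbar ^ 2 + (1 + Ybar) ^ 2) := by ring
      _ < Wbar := by rw [hcQ]; linarith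
  have hext : ∀ s (hs : s ∈ Set.Icc (0:ℝ) 1),
      Set.IccExtend (zero_le_one' ℝ) g s = g ⟨s, hs⟩ := fun s hs =>
    Set.IccExtend_of_mem _ _ hs
  refine ⟨Set.IccExtend (zero_le_one' ℝ) g, g.continuous.Icc_extend'.continuousOn, ?_, ?_, ?_, ?_⟩
  · rw [hext 0 (by simp), hg]
    simp [rpowAverage]
  · intro s hs
    have hs' : s ∈ Set.Icc (0:ℝ) 1 := ⟨hs.1.le, hs.2⟩
    rw [hext s hs', hg ⟨s, hs'⟩]
    exact hconv g _ (fun t => by rw [hext t t.2]; exact ⟨rfl, hgb t⟩) s hs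
  · intro s hs
    rw [hext s hs]
    exact hgb _
  · intro W' hW'c hW'0 hW'eq hW'b s hs
    have heq := hguniq ⟨Set.domRestrict _ W', hW'c.domRestrict⟩ fun t => by
      rcases t.2.1.eq_or_lt with ht | ht
      · rw [← ht, rpowAverage, zero_mul, mul_zero, ContinuousMap.coe_mk, Set.domRestrict_apply,
          ← ht, hW'0]
      · have ht' : (t : ℝ) ∈ Set.Ioc (0:ℝ) 1 := ⟨ht, t.2.2⟩
        rw [hconv _ W' (fun u => ⟨rfl, hW'b u u.2⟩) t ht']
        exact hW'eq t ht'
    rw [hext s hs, ← heq]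
    rfl
end

section
/- Let r > 0 and K ≥ 0 be real numbers and let f : [0,1] → ℝ be continuous on [0,1], differentiable on (0,1], with f(0) < 0, and suppose f′(s) ≤ −((r+1)/s)·f(s) + K·|f(s)| for all s ∈ (0,1]. Then f(s) ≤ 0 for all s ∈ [0,1]. -/
/-- Comparison argument of Step 4: if `f` is continuous on `[0,1]`, differentiable on
`(0,1]` with `f(0) < 0` and `f′(s) ≤ −((r+1)/s)·f(s) + K·|f(s)|`, then `f ≤ 0` on `[0,1]`. -/
theorem stmt_17 (r K : ℝ) (hr : 0 < r) (hK : 0 ≤ K)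
    (f f' : ℝ → ℝ) (hfc : ContinuousOn f (Set.Icc 0 1))
    (hf0 : f 0 < 0)
    (hderiv : ∀ s ∈ Set.Ioc (0:ℝ) 1, HasDerivWithinAt f (f' s) (Set.Icc 0 1) s)
    (hineq : ∀ s ∈ Set.Ioc (0:ℝ) 1, f' s ≤ -((r + 1) / s) * f s + K * |f s|) :
    ∀ s ∈ Set.Icc (0:ℝ) 1, f s ≤ 0 := by
  intro b hb
  by_contra! hpos
  have hsub : Set.Icc 0 b ⊆ Set.Icc (0:ℝ) 1 := Set.Icc_subset_Icc_right hb.2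
  have hcompact : IsCompact (Set.Icc 0 b ∩ f ⁻¹' Set.Iic 0) :=
    isCompact_Icc.of_isClosed_subset
      ((hfc.mono hsub).preimage_isClosed_of_isClosed isClosed_Icc isClosed_Iic)
      Set.inter_subset_left
  obtain ⟨a, ⟨ha, hfa⟩, hmax⟩ := hcompact.exists_isGreatest ⟨0, ⟨le_rfl, hb.1⟩, hf0.le⟩
  have hfpos : ∀ s ∈ Set.Ioo a b, 0 < f s := by
    intro s hs
    by_contra! hfs
    exact hs.1.not_ge (hmax ⟨⟨ha.1.trans hs.1.le, hs.2.le⟩, hfs⟩)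
  have hanti : AntitoneOn (fun s => f s * Real.exp (-K * s)) (Set.Icc a b) := by
    refine antitoneOn_of_hasDerivWithinAt_nonpos (convex_Icc a b)
      (f' := fun s => f' s * Real.exp (-K * s) + f s * (Real.exp (-K * s) * (-K * 1))) ?_ ?_ ?_
    · exact (hfc.mono (Set.Icc_subset_Icc ha.1 hb.2)).mul (by fun_prop)
    · intro s hs
      rw [interior_Icc] at hs ⊢
      have hs' : s ∈ Set.Ioc (0:ℝ) 1 := ⟨ha.1.trans_lt hs.1, hs.2.le.trans hb.2⟩
      exact ((hderiv s hs').mono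
        (Set.Ioo_subset_Icc_self.trans (Set.Icc_subset_Icc ha.1 hb.2))).mul
        (((hasDerivAt_id s).const_mul (-K)).exp.hasDerivWithinAt)
    · intro s hs
      rw [interior_Icc] at hs
      have hs0 : 0 < s := ha.1.trans_lt hs.1
      have hfs := hfpos s hs
      have hle := hineq s ⟨hs0, hs.2.le.trans hb.2⟩
      rw [abs_of_pos hfs] at hle
      have hterm : 0 ≤ (r + 1) / s * f s := by positivity
      have hdiff : f' s - K * f s ≤ 0 := by linarith
      linarith [mul_nonpos_of_nonpos_of_nonneg hdiff (Real.exp_pos (-K * s)).le]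
  have hle := hanti (Set.left_mem_Icc.2 ha.2) (Set.right_mem_Icc.2 ha.2) ha.2
  have hright := mul_pos hpos (Real.exp_pos (-K * b))
  have hleft := mul_nonpos_of_nonpos_of_nonneg hfa (Real.exp_pos (-K * a)).le
  exact hright.not_ge (hle.trans hleft)
end

section
/- Let r, ψ, σ̄ be positive real numbers with σ̄²ψ < r/2, let σ : [0,1] → ℝ be continuous with 0 < σ(t) ≤ σ̄, and let A : [0,1] → ℝ be the unique nonnegative function, continuous on [0,1] and continuously differentiable on [0,1), with A(1) = 0 and −A′(t) = (r/(1−t))·(−A(t) + (σ(t)²ψ/2)·A(t)²) + 1 on [0,1). Then there exists a function D : [0,1] → ℝ, continuous on [0,1], continuously differentiable on [0,1), with D(1) = 0 and 0 ≤ D(t) ≤ ψ·A(t) for all t ∈ [0,1], such that −D′(t) = −(r/(1−t))·D(t) + (1/2)·(r/(1−t))·σ(t)²·D(t)² + (σ(t)²·ψ²·A(t)²/2)·(r/(1−t)) for all t ∈ [0,1). In particular sup_{t ∈ [0,1]} |D(t)| < +∞. -/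
open Set Filter Topology

/-- A continuous, nonnegative supersolution `U` of the averaged quadratic equation
`D x = ∫ v in 0..1, (a * D ^ 2 + b) (x * v)` on `[0, 1]` dominates a nonnegative solution,
provided that the quadratic operator contracts below `U`. -/
theorem exists_averaged_quadratic_solution {a b U : ℝ → ℝ} {q : ℝ}
    (ha : Continuous a) (hb : Continuous b) (hU : Continuous U)
    (ha0 : ∀ x ∈ Icc (0 : ℝ) 1, 0 ≤ a x) (hb0 : ∀ x ∈ Icc (0 : ℝ) 1, 0 ≤ b x)
    (hU0 : ∀ x ∈ Icc (0 : ℝ) 1, 0 ≤ U x) (hq : q < 1)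
    (haU : ∀ x ∈ Icc (0 : ℝ) 1, 2 * a x * U x ≤ q)
    (hsuper : ∀ x ∈ Icc (0 : ℝ) 1,
      ∫ v in (0 : ℝ)..1, (a (x * v) * U (x * v) ^ 2 + b (x * v)) ≤ U x) :
    ∃ D : ℝ → ℝ, Continuous D ∧ (∀ x ∈ Icc (0 : ℝ) 1, 0 ≤ D x ∧ D x ≤ U x) ∧
      ∀ x ∈ Icc (0 : ℝ) 1, D x = ∫ v in (0 : ℝ)..1, (a (x * v) * D (x * v) ^ 2 + b (x * v)) := by
  let e : C(Icc (0 : ℝ) 1, ℝ) → ℝ → ℝ := fun f x => f (projIcc 0 1 zero_le_one x)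
  have he : ∀ f, Continuous (e f) := fun f => f.continuous.comp continuous_projIcc
  have hmul : ∀ x ∈ Icc (0 : ℝ) 1, ∀ v ∈ Icc (0 : ℝ) 1, x * v ∈ Icc (0 : ℝ) 1 :=
    fun x hx v hv => ⟨mul_nonneg hx.1 hv.1, mul_le_one₀ hx.2 hv.1 hv.2⟩
  have hcont : ∀ f : C(Icc (0 : ℝ) 1, ℝ),
      Continuous fun y => a y * e f y ^ 2 + b y :=
    fun f => (ha.mul ((he f).pow 2)).add hb
  have hint : ∀ (f : C(Icc (0 : ℝ) 1, ℝ)) (x : ℝ), IntervalIntegrable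
      (fun v => a (x * v) * e f (x * v) ^ 2 + b (x * v)) MeasureTheory.volume 0 1 :=
    fun f x => ((hcont f).comp (continuous_const.mul continuous_id)).intervalIntegrable _ _
  let T : C(Icc (0 : ℝ) 1, ℝ) → C(Icc (0 : ℝ) 1, ℝ) := fun f =>
    ⟨fun x => ∫ v in (0 : ℝ)..1, (a (x * v) * e f (x * v) ^ 2 + b (x * v)), by
      apply intervalIntegral.continuous_parametric_intervalIntegral_of_continuous'
      exact (hcont f).comp ((continuous_subtype_val.comp continuous_fst).mul continuous_snd)⟩
  have hT : ∀ f x, T f x = ∫ v in (0 : ℝ)..1, (a (x * v) * e f (x * v) ^ 2 + b (x * v)) :=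
    fun _ _ => rfl
  let s : Set C(Icc (0 : ℝ) 1, ℝ) := {f | ∀ x, 0 ≤ f x ∧ f x ≤ U x}
  have hs : IsClosed s := by
    simp only [s, ofPred_forall]
    refine isClosed_iInter fun x => ?_
    have hx : Continuous fun f : C(Icc (0 : ℝ) 1, ℝ) => f x := continuous_eval_const x
    exact (isClosed_le continuous_const hx).inter (isClosed_le hx continuous_const)
  have hes : ∀ f ∈ s, ∀ y ∈ Icc (0 : ℝ) 1, 0 ≤ e f y ∧ e f y ≤ U y := by
    intro f hf y hy
    have := hf ⟨y, hy⟩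
    simpa only [e, projIcc_of_mem _ hy] using this
  have hmaps : MapsTo T s s := by
    intro f hf x
    rw [hT]
    constructor
    · refine intervalIntegral.integral_nonneg zero_le_one fun v hv => ?_
      have hxv := hmul x x.2 v hv
      exact add_nonneg (mul_nonneg (ha0 _ hxv) (sq_nonneg _)) (hb0 _ hxv)
    · refine le_trans (intervalIntegral.integral_mono_on zero_le_one (hint f x) ?_ ?_)
        (hsuper x x.2)
      · exact (((ha.mul (hU.pow 2)).add hb).comp
          (continuous_const.mul continuous_id)).intervalIntegrable _ _
      · intro v hv
        have hxv := hmul x x.2 v hv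
        have h1 := hes f hf _ hxv
        have h2 := ha0 _ hxv
        have h3 : e f (x * v) ^ 2 ≤ U (x * v) ^ 2 := pow_le_pow_left₀ h1.1 h1.2 2
        gcongr
  have hq0 : 0 ≤ q := by
    have h0 : (0 : ℝ) ∈ Icc (0 : ℝ) 1 := by simp
    have := mul_nonneg (mul_nonneg zero_le_two (ha0 _ h0)) (hU0 _ h0)
    linarith [haU _ h0]
  have hcontr : ContractingWith ⟨q, hq0⟩ (hmaps.restrict T s s) := by
    refine ⟨by exact_mod_cast hq, LipschitzWith.of_dist_le_mul ?_⟩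
    rintro ⟨f, hf⟩ ⟨g, hg⟩
    change dist (T f) (T g) ≤ q * dist f g
    refine (ContinuousMap.dist_le (by positivity)).2 fun x => ?_
    rw [hT, hT, dist_eq_norm, ← intervalIntegral.integral_sub (hint f x) (hint g x)]
    have hb' := intervalIntegral.norm_integral_le_of_norm_le_const (a := 0) (b := 1)
      (C := q * dist f g)
      (f := fun v => (a (x * v) * e f (x * v) ^ 2 + b (x * v)) -
        (a (x * v) * e g (x * v) ^ 2 + b (x * v))) ?_
    · simpa using hb'
    intro v hv
    rw [uIoc_of_le zero_le_one] at hv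
    have hxv := hmul x x.2 v ⟨hv.1.le, hv.2⟩
    have h1 := hes f hf _ hxv
    have h2 := hes g hg _ hxv
    have h3 : |e f (x * v) - e g (x * v)| ≤ dist f g := by
      rw [← Real.dist_eq]
      exact ContinuousMap.dist_apply_le_dist _
    have h4 := ha0 _ hxv
    have h5 : a (x * v) * (e f (x * v) + e g (x * v)) ≤ q := by
      refine le_trans ?_ (haU _ hxv)
      nlinarith
    rw [show (a (x * v) * e f (x * v) ^ 2 + b (x * v)) - (a (x * v) * e g (x * v) ^ 2 + b (x * v))
      = (a (x * v) * (e f (x * v) + e g (x * v))) * (e f (x * v) - e g (x * v)) by ring,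
      Real.norm_eq_abs, abs_mul, abs_of_nonneg (mul_nonneg h4 (add_nonneg h1.1 h2.1))]
    exact mul_le_mul h5 h3 (abs_nonneg _) hq0
  have h0s : (0 : C(Icc (0 : ℝ) 1, ℝ)) ∈ s := fun x => ⟨le_rfl, hU0 x x.2⟩
  obtain ⟨f, hfs, hf, -⟩ :=
    ContractingWith.exists_fixedPoint' hs.isComplete hmaps hcontr h0s (edist_ne_top _ _)
  refine ⟨e f, he f, hes f hfs, fun x hx => ?_⟩
  have h := DFunLike.congr_fun hf ⟨x, hx⟩
  rw [hT] at h
  rw [h]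
  simp only [e, projIcc_of_mem _ hx]

/-- The linear barrier `2 (1 - t) / r` for nonnegative solutions of the terminal value problem
for `A`. -/
theorem terminal_riccati_le_linear {r ψ σbar : ℝ} (hr : 0 < r) (hψ : 0 < ψ)
    {σ A A' : ℝ → ℝ} (hσb : ∀ t ∈ Icc (0 : ℝ) 1, 0 < σ t ∧ σ t ≤ σbar)
    (hsmall : σbar ^ 2 * ψ < r / 2)
    (hAc : ContinuousOn A (Icc 0 1))
    (hApos : ∀ t ∈ Icc (0 : ℝ) 1, 0 ≤ A t) (hA1 : A 1 = 0)
    (hAderiv : ∀ t ∈ Ico (0 : ℝ) 1, HasDerivWithinAt A (A' t) (Icc 0 1) t)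
    (hAode : ∀ t ∈ Ico (0 : ℝ) 1,
      -A' t = r / (1 - t) * (-A t + (σ t) ^ 2 * ψ / 2 * (A t) ^ 2) + 1)
    {t : ℝ} (ht : t ∈ Icc (0 : ℝ) 1) : A t ≤ 2 * (1 - t) / r := by
  by_contra! hlt
  let S : Set ℝ := {x ∈ Icc t 1 | A x ≤ 2 * (1 - x) / r}
  have hsub : Icc t 1 ⊆ Icc 0 1 := Icc_subset_Icc_left ht.1
  have hScl : IsClosed S :=
    isClosed_Icc.isClosed_le (hAc.mono hsub) (by fun_prop)
  obtain ⟨t₀, ⟨ht₀, hAt₀⟩, hleast⟩ :=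
    (isCompact_Icc.of_isClosed_subset hScl fun x hx => hx.1).exists_isLeast
      ⟨1, ⟨ht.2, le_rfl⟩, by simp [hA1]⟩
  have htt₀ : t < t₀ := by
    refine lt_of_le_of_ne ht₀.1 fun h => ?_
    rw [← h] at hAt₀
    linarith
  have habove : ∀ x ∈ Ico t t₀, 2 * (1 - x) / r < A x := by
    intro x hx
    by_contra! hx'
    exact absurd (hleast ⟨⟨hx.1, hx.2.le.trans ht₀.2⟩, hx'⟩) (not_le.2 hx.2)
  have hsmall₀ : σbar ^ 2 * ψ * A t₀ < 1 := by
    have h1 : r * A t₀ < 2 := by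
      rw [le_div_iff₀ hr] at hAt₀
      linarith [ht.1]
    have h2 := mul_le_mul_of_nonneg_right hsmall.le (hApos t₀ (hsub ht₀))
    linarith
  have hev : ∀ᶠ x in 𝓝[Icc 0 1] t₀, σbar ^ 2 * ψ * A x < 1 :=
    ((hAc t₀ (hsub ht₀)).const_mul (σbar ^ 2 * ψ)).eventually_lt_const hsmall₀
  obtain ⟨ε, hε, hball⟩ := Metric.mem_nhdsWithin_iff.1 hev
  obtain ⟨u, hu₁, hu₂⟩ := exists_between (max_lt htt₀ (sub_lt_self t₀ hε))
  rw [max_lt_iff] at hu₁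
  have hloc : ∀ x ∈ Icc u t₀, σbar ^ 2 * ψ * A x < 1 := by
    intro x hx
    refine hball ⟨?_, ?_⟩
    · rw [Metric.mem_ball, Real.dist_eq, abs_lt]
      constructor <;> linarith [hx.1, hx.2]
    · exact ⟨by linarith [hx.1, ht.1], hx.2.trans ht₀.2⟩
  have hsub' : Icc u t₀ ⊆ Icc 0 1 := Icc_subset_Icc (by linarith [ht.1]) ht₀.2
  have hder : ∀ x ∈ Ioo u t₀, HasDerivAt A (A' x) x := by
    intro x hx
    have hx0 : 0 < x := by linarith [hx.1, ht.1]
    have hx1 : x < 1 := hx.2.trans_le ht₀.2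
    exact (hAderiv x ⟨hx0.le, hx1⟩).hasDerivAt (Icc_mem_nhds hx0 hx1)
  have hmono : MonotoneOn A (Icc u t₀) := by
    refine monotoneOn_of_deriv_nonneg (convex_Icc _ _) (hAc.mono hsub') ?_ ?_
    · rw [interior_Icc]
      exact fun x hx => (hder x hx).differentiableAt.differentiableWithinAt
    · rw [interior_Icc]
      intro x hx
      rw [(hder x hx).deriv]
      have hx01 : x ∈ Icc (0 : ℝ) 1 := hsub' (Ioo_subset_Icc_self hx)
      have hx1 : x < 1 := hx.2.trans_le ht₀.2
      have hs : 0 < 1 - x := sub_pos.2 hx1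
      have hode := hAode x ⟨hx01.1, hx1⟩
      have hA := hApos x hx01
      have hl := hloc x (Ioo_subset_Icc_self hx)
      have hab := habove x ⟨by linarith [hx.1], hx.2⟩
      obtain ⟨hσ0, hσ1⟩ := hσb x hx01
      have hsq : σ x ^ 2 ≤ σbar ^ 2 := pow_le_pow_left₀ hσ0.le hσ1 2
      have h1 : σ x ^ 2 * ψ * A x ≤ 1 := by
        refine le_trans ?_ hl.le
        gcongr
      have h2 : -A x + σ x ^ 2 * ψ / 2 * A x ^ 2 ≤ -((1 - x) / r) := by
        rw [mul_div_assoc] at hab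
        nlinarith
      have h3 := mul_le_mul_of_nonneg_left h2 (div_pos hr hs).le
      have h4 : r / (1 - x) * -((1 - x) / r) = -1 := by
        field_simp
      linarith
  have h1 := hmono ⟨le_rfl, hu₂.le⟩ ⟨hu₂.le, le_rfl⟩ hu₂.le
  have h2 := habove u ⟨hu₁.1.le, hu₂⟩
  have h3 : 2 * (1 - t₀) / r ≤ 2 * (1 - u) / r := by gcongr
  linarith

/-- The time `1 - v ^ (1 / r)`, with `v` clamped to `[0, 1]`; it turns the weights
`r s ^ (r - 1)` into the uniform one. -/
noncomputable def powerTime (r v : ℝ) : ℝ :=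
  1 - ((projIcc (0 : ℝ) 1 zero_le_one v : Icc (0 : ℝ) 1) : ℝ) ^ r⁻¹

theorem continuous_powerTime {r : ℝ} (hr : 0 < r) : Continuous (powerTime r) :=
  continuous_const.sub ((continuous_subtype_val.comp continuous_projIcc).rpow_const
    fun _ => Or.inr (inv_pos.2 hr).le)

theorem powerTime_mem {r : ℝ} (hr : 0 < r) (v : ℝ) : powerTime r v ∈ Icc (0 : ℝ) 1 := by
  have h := (projIcc (0 : ℝ) 1 zero_le_one v).2
  exact ⟨sub_nonneg.2 (Real.rpow_le_one h.1 h.2 (inv_pos.2 hr).le),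
    sub_le_self _ (Real.rpow_nonneg h.1 _)⟩

theorem powerTime_of_mem (r : ℝ) {v : ℝ} (hv : v ∈ Icc (0 : ℝ) 1) :
    powerTime r v = 1 - v ^ r⁻¹ := by
  simp only [powerTime, projIcc_of_mem _ hv]

theorem powerTime_zero {r : ℝ} (hr : 0 < r) : powerTime r 0 = 1 := by
  rw [powerTime_of_mem r ⟨le_rfl, zero_le_one⟩, Real.zero_rpow (inv_pos.2 hr).ne', sub_zero]

theorem one_sub_rpow_mem {r t : ℝ} (hr : 0 < r) (ht : t ∈ Icc (0 : ℝ) 1) :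
    (1 - t) ^ r ∈ Icc (0 : ℝ) 1 := by
  have h0 : 0 ≤ 1 - t := sub_nonneg.2 ht.2
  exact ⟨Real.rpow_nonneg h0 _, Real.rpow_le_one h0 (by linarith [ht.1]) hr.le⟩

theorem powerTime_one_sub_rpow {r t : ℝ} (hr : 0 < r) (ht : t ∈ Icc (0 : ℝ) 1) :
    powerTime r ((1 - t) ^ r) = t := by
  rw [powerTime_of_mem r (one_sub_rpow_mem hr ht), Real.rpow_rpow_inv (sub_nonneg.2 ht.2) hr.ne']
  ring

theorem powerTime_mem_Ioo {r v : ℝ} (hr : 0 < r) (hv : v ∈ Ioo (0 : ℝ) 1) :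
    powerTime r v ∈ Ioo (0 : ℝ) 1 := by
  have hs : 0 < v ^ r⁻¹ := Real.rpow_pos_of_pos hv.1 _
  have hs1 : v ^ r⁻¹ < 1 := Real.rpow_lt_one hv.1.le hv.2 (inv_pos.2 hr)
  rw [powerTime_of_mem r (Ioo_subset_Icc_self hv)]
  constructor <;> linarith

theorem hasDerivAt_powerTime (r : ℝ) {v : ℝ} (hv : v ∈ Ioo (0 : ℝ) 1) :
    HasDerivAt (powerTime r) (-(r⁻¹ * ((1 - powerTime r v) / v))) v := by
  have h := (Real.hasDerivAt_rpow_const (x := v) (p := r⁻¹) (Or.inl hv.1.ne')).const_sub 1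
  rw [Real.rpow_sub_one hv.1.ne'] at h
  rw [powerTime_of_mem r (Ioo_subset_Icc_self hv), sub_sub_cancel]
  refine h.congr_of_eventuallyEq ?_
  filter_upwards [Icc_mem_nhds hv.1 hv.2] with y hy using powerTime_of_mem r hy

/-- The terminal value problem for `A`, integrated in the variable `v = (1 - t) ^ r`. -/
theorem terminal_riccati_integral {r ψ : ℝ} (hr : 0 < r)
    {σ A A' : ℝ → ℝ} (hσc : ContinuousOn σ (Icc 0 1)) (hAc : ContinuousOn A (Icc 0 1))
    (hAderiv : ∀ t ∈ Ico (0 : ℝ) 1, HasDerivWithinAt A (A' t) (Icc 0 1) t)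
    (hAode : ∀ t ∈ Ico (0 : ℝ) 1,
      -A' t = r / (1 - t) * (-A t + (σ t) ^ 2 * ψ / 2 * (A t) ^ 2) + 1)
    {x : ℝ} (hx : x ∈ Icc (0 : ℝ) 1) :
    ∫ v in (0 : ℝ)..x, (σ (powerTime r v) ^ 2 / 2 * (ψ * A (powerTime r v)) ^ 2 +
      ψ * (1 - powerTime r v) / r) = x * (ψ * A (powerTime r x)) := by
  have hθc := continuous_powerTime hr
  have hσθ : Continuous fun v => σ (powerTime r v) := hσc.comp_continuous hθc (powerTime_mem hr)
  have hAθ : Continuous fun v => A (powerTime r v) := hAc.comp_continuous hθc (powerTime_mem hr)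
  have hderiv : ∀ v ∈ Ioo 0 x, HasDerivAt (fun v => v * (ψ * A (powerTime r v)))
      (σ (powerTime r v) ^ 2 / 2 * (ψ * A (powerTime r v)) ^ 2 +
        ψ * (1 - powerTime r v) / r) v := by
    intro v hv
    have hvI : v ∈ Ioo (0 : ℝ) 1 := ⟨hv.1, hv.2.trans_le hx.2⟩
    have hθI := powerTime_mem_Ioo hr hvI
    have hAd : HasDerivAt A (A' (powerTime r v)) (powerTime r v) :=
      (hAderiv _ ⟨hθI.1.le, hθI.2⟩).hasDerivAt (Icc_mem_nhds hθI.1 hθI.2)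
    refine ((hasDerivAt_id v).mul
      ((hAd.comp v (hasDerivAt_powerTime r hvI)).const_mul ψ)).congr_deriv ?_
    have hode := hAode _ ⟨hθI.1.le, hθI.2⟩
    have hs : 1 - powerTime r v ≠ 0 := (sub_pos.2 hθI.2).ne'
    have hv0 := hv.1.ne'
    rw [neg_eq_iff_eq_neg] at hode
    simp only [id, Function.comp]
    rw [hode]
    generalize powerTime r v = t at *
    field_simp
    ring
  rw [intervalIntegral.integral_eq_sub_of_hasDerivAt_of_le hx.1
    (continuous_id.mul (continuous_const.mul hAθ)).continuousOn hderiv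
    (((hσθ.pow 2).div_const 2 |>.mul ((continuous_const.mul hAθ).pow 2)).add
      ((continuous_const.mul (continuous_const.sub hθc)).div_const r)
      |>.intervalIntegrable _ _)]
  simp

/-- Verification of the Novikov condition: the Riccati equation (84)
`−D′(t) = −(r/(1−t))·D(t) + (1/2)(r/(1−t))σ(t)²D(t)² + (σ(t)²ψ²A(t)²/2)(r/(1−t))`
admits a solution `D` with `D(1) = 0` and `0 ≤ D(t) ≤ ψA(t)`; in particular `D` is
bounded on `[0,1]`. -/
theorem stmt_18 (r ψ σbar : ℝ) (hr : 0 < r) (hψ : 0 < ψ) (hσ : 0 < σbar)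
    (hsmall : σbar ^ 2 * ψ < r / 2)
    (σ : ℝ → ℝ) (hσc : ContinuousOn σ (Set.Icc 0 1))
    (hσb : ∀ t ∈ Set.Icc (0:ℝ) 1, 0 < σ t ∧ σ t ≤ σbar)
    (A A' : ℝ → ℝ) (hAc : ContinuousOn A (Set.Icc 0 1))
    (hApos : ∀ t ∈ Set.Icc (0:ℝ) 1, 0 ≤ A t) (hA1 : A 1 = 0)
    (hAderiv : ∀ t ∈ Set.Ico (0:ℝ) 1, HasDerivWithinAt A (A' t) (Set.Icc 0 1) t)
    (hA'c : ContinuousOn A' (Set.Ico 0 1))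
    (hAode : ∀ t ∈ Set.Ico (0:ℝ) 1,
      -A' t = r / (1 - t) * (-A t + (σ t) ^ 2 * ψ / 2 * (A t) ^ 2) + 1) :
    ∃ D D' : ℝ → ℝ,
      ContinuousOn D (Set.Icc 0 1) ∧ D 1 = 0 ∧
      (∀ t ∈ Set.Icc (0:ℝ) 1, 0 ≤ D t ∧ D t ≤ ψ * A t) ∧
      (∀ t ∈ Set.Ico (0:ℝ) 1, HasDerivWithinAt D (D' t) (Set.Icc 0 1) t) ∧
      ContinuousOn D' (Set.Ico 0 1) ∧
      (∀ t ∈ Set.Ico (0:ℝ) 1,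
        -D' t = -(r / (1 - t)) * D t + 1 / 2 * (r / (1 - t)) * (σ t) ^ 2 * (D t) ^ 2 +
          (σ t) ^ 2 * ψ ^ 2 * (A t) ^ 2 / 2 * (r / (1 - t))) ∧
      ∃ C : ℝ, ∀ t ∈ Set.Icc (0:ℝ) 1, |D t| ≤ C := by
  have hθc := continuous_powerTime hr
  have hθm := powerTime_mem hr
  have hθinv : ∀ t ∈ Icc (0 : ℝ) 1, powerTime r ((1 - t) ^ r) = t :=
    fun t ht => powerTime_one_sub_rpow hr ht
  have hbarrier : ∀ t ∈ Icc (0 : ℝ) 1, A t ≤ 2 * (1 - t) / r := fun t ht =>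
    terminal_riccati_le_linear hr hψ hσb hsmall hAc hApos hA1 hAderiv hAode ht
  have hσθ : Continuous fun v => σ (powerTime r v) := hσc.comp_continuous hθc hθm
  have hAθ : Continuous fun v => A (powerTime r v) := hAc.comp_continuous hθc hθm
  have hac : Continuous fun v => σ (powerTime r v) ^ 2 / 2 := (hσθ.pow 2).div_const 2
  have hUc : Continuous fun v => ψ * A (powerTime r v) := continuous_const.mul hAθ
  have hbc : Continuous fun v => σ (powerTime r v) ^ 2 / 2 * (ψ * A (powerTime r v)) ^ 2 :=
    hac.mul (hUc.pow 2)
  have hsq : ∀ t ∈ Icc (0 : ℝ) 1, σ t ^ 2 ≤ σbar ^ 2 := fun t ht =>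
    pow_le_pow_left₀ (hσb t ht).1.le (hσb t ht).2 2
  have hcoef : ∀ t ∈ Icc (0 : ℝ) 1, σ t ^ 2 * (ψ * A t) ≤ 1 - t := by
    intro t ht
    calc σ t ^ 2 * (ψ * A t) ≤ σbar ^ 2 * (ψ * A t) :=
          mul_le_mul_of_nonneg_right (hsq t ht) (mul_nonneg hψ.le (hApos t ht))
      _ = σbar ^ 2 * ψ * A t := by ring
      _ ≤ r / 2 * (2 * (1 - t) / r) :=
          mul_le_mul hsmall.le (hbarrier t ht) (hApos t ht) (by positivity)
      _ = 1 - t := by field_simp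
  obtain ⟨D, hDc, hDb, hDeq⟩ := exists_averaged_quadratic_solution
    (a := fun v => σ (powerTime r v) ^ 2 / 2) (U := fun v => ψ * A (powerTime r v))
    (b := fun v => σ (powerTime r v) ^ 2 / 2 * (ψ * A (powerTime r v)) ^ 2)
    (q := σbar ^ 2 * ψ * (2 / r))
    hac hbc hUc
    (fun x _ => by positivity) (fun x _ => by positivity)
    (fun x _ => mul_nonneg hψ.le (hApos _ (hθm x)))
    (by
      calc σbar ^ 2 * ψ * (2 / r) < r / 2 * (2 / r) := by gcongr
        _ = 1 := by field_simp)
    (by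
      intro x _
      have h1 := hsq _ (hθm x)
      have h2 := hApos _ (hθm x)
      have h3 : A (powerTime r x) ≤ 2 / r := by
        refine (hbarrier _ (hθm x)).trans ?_
        gcongr
        linarith [(hθm x).1]
      calc 2 * (σ (powerTime r x) ^ 2 / 2) * (ψ * A (powerTime r x))
          = σ (powerTime r x) ^ 2 * ψ * A (powerTime r x) := by ring
        _ ≤ σbar ^ 2 * ψ * (2 / r) := by gcongr)
    (by
      intro x hx
      rcases hx.1.eq_or_lt with rfl | hx0
      · simp [powerTime_zero hr, hA1]
      refine le_of_mul_le_mul_left ?_ hx0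
      rw [intervalIntegral.mul_integral_comp_mul_left
        (f := fun v => σ (powerTime r v) ^ 2 / 2 * (ψ * A (powerTime r v)) ^ 2 +
          σ (powerTime r v) ^ 2 / 2 * (ψ * A (powerTime r v)) ^ 2),
        mul_zero, mul_one, ← terminal_riccati_integral hr hσc hAc hAderiv hAode hx]
      refine intervalIntegral.integral_mono_on hx.1
        ((hbc.add hbc).intervalIntegrable _ _)
        ((hbc.add ((continuous_const.mul (continuous_const.sub hθc)).div_const r)
          ).intervalIntegrable _ _) fun v _ => ?_
      refine add_le_add le_rfl ?_
      calc σ (powerTime r v) ^ 2 / 2 * (ψ * A (powerTime r v)) ^ 2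
          = ψ / 2 * (σ (powerTime r v) ^ 2 * (ψ * A (powerTime r v)) * A (powerTime r v)) := by ring
        _ ≤ ψ / 2 * (1 * (2 * (1 - powerTime r v) / r)) := by
          have h1 := (hcoef _ (hθm v)).trans (sub_le_self 1 (hθm v).1)
          have h2 := mul_le_mul h1 (hbarrier _ (hθm v)) (hApos _ (hθm v)) zero_le_one
          gcongr
        _ = ψ * (1 - powerTime r v) / r := by ring)
  let G : ℝ → ℝ := fun v => σ (powerTime r v) ^ 2 / 2 * D v ^ 2 +
    σ (powerTime r v) ^ 2 / 2 * (ψ * A (powerTime r v)) ^ 2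
  have hG : Continuous G := (hac.mul (hDc.pow 2)).add hbc
  have hDG : ∀ x ∈ Icc (0 : ℝ) 1, x * D x = ∫ v in (0 : ℝ)..x, G v := by
    intro x hx
    rw [hDeq x hx, intervalIntegral.mul_integral_comp_mul_left (f := G), mul_zero, mul_one]
  have hpowc : Continuous fun t : ℝ => (1 - t) ^ r :=
    (continuous_const.sub continuous_id).rpow_const fun _ => Or.inr hr.le
  have hbound : ∀ t ∈ Icc (0 : ℝ) 1, 0 ≤ D ((1 - t) ^ r) ∧ D ((1 - t) ^ r) ≤ ψ * A t := by
    intro t ht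
    have h := hDb _ (one_sub_rpow_mem hr ht)
    rwa [hθinv t ht] at h
  have hEc : Continuous fun t : ℝ => D ((1 - t) ^ r) := hDc.comp hpowc
  refine ⟨fun t => D ((1 - t) ^ r), fun t => -(-(r / (1 - t)) * D ((1 - t) ^ r) +
    1 / 2 * (r / (1 - t)) * σ t ^ 2 * D ((1 - t) ^ r) ^ 2 +
      σ t ^ 2 * ψ ^ 2 * A t ^ 2 / 2 * (r / (1 - t))), hEc.continuousOn, ?_, hbound, ?_, ?_,
      fun t _ => neg_neg _, ?_⟩
  · have h := hbound 1 ⟨zero_le_one, le_rfl⟩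
    rw [hA1, mul_zero] at h
    exact le_antisymm h.2 h.1
  · intro t ht
    have htI : t ∈ Icc (0 : ℝ) 1 := ⟨ht.1, ht.2.le⟩
    have hs : 0 < 1 - t := sub_pos.2 ht.2
    have hτ : 0 < (1 - t) ^ r := Real.rpow_pos_of_pos hs r
    have hp : HasDerivAt (fun t : ℝ => (1 - t) ^ r) (-1 * r * (1 - t) ^ (r - 1)) t :=
      ((hasDerivAt_id t).const_sub 1).rpow_const (Or.inl hs.ne')
    have hI : HasDerivAt (fun u => ∫ v in (0 : ℝ)..u, G v) (G ((1 - t) ^ r)) ((1 - t) ^ r) :=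
      (hG.integral_hasStrictDerivAt 0 _).hasDerivAt
    have hquot := (hI.comp t hp).div hp hτ.ne'
    have hev : (fun t => D ((1 - t) ^ r)) =ᶠ[𝓝[Icc 0 1] t]
        fun t => (∫ v in (0 : ℝ)..(1 - t) ^ r, G v) / (1 - t) ^ r := by
      filter_upwards [self_mem_nhdsWithin, mem_nhdsWithin_of_mem_nhds (Iio_mem_nhds ht.2)]
        with y hy hy1
      have hy0 : (1 - y) ^ r ≠ 0 := (Real.rpow_pos_of_pos (sub_pos.2 hy1) r).ne'
      rw [← hDG _ (one_sub_rpow_mem hr hy), mul_div_cancel_left₀ _ hy0]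
    refine (hquot.hasDerivWithinAt.congr_of_eventuallyEq_of_mem hev htI).congr_deriv ?_
    simp only [Function.comp]
    rw [← hDG _ (one_sub_rpow_mem hr htI), Real.rpow_sub_one hs.ne']
    simp only [G, hθinv t htI]
    field_simp
    ring
  · have hsub : Ico (0 : ℝ) 1 ⊆ Icc 0 1 := Ico_subset_Icc_self
    have hk : ContinuousOn (fun t : ℝ => r / (1 - t)) (Ico 0 1) :=
      continuousOn_const.div (by fun_prop) fun t ht => (sub_pos.2 ht.2).ne'
    have hE' : ContinuousOn (fun t : ℝ => D ((1 - t) ^ r)) (Ico 0 1) := hEc.continuousOn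
    have hσ' := (hσc.mono hsub).pow 2
    have hA' := (hAc.mono hsub).pow 2
    exact (((hk.neg.mul hE').add (((continuousOn_const.mul hk).mul hσ').mul (hE'.pow 2))).add
      ((((hσ'.mul continuousOn_const).mul hA').div_const 2).mul hk)).neg
  · obtain ⟨C, hC⟩ := isCompact_Icc.exists_bound_of_continuousOn hEc.continuousOn
    exact ⟨C, hC⟩
end
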